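/- arXiv:1506.04963 — 3 statements merged into one kernel-verified Lean document; each statement's English description precedes it below -/
import Mathlib

section
/- Fix n ≥ 1 and a symmetric set S ⊆ {1,…,n} with n ∉ S, S = {ℓ_1,…,ℓ_s}. Then as formal identities (with x = z^{1/2} − z^{-1/2}): ∑_{k≥0} (−1)^k A_{S,n,k}(q) x^{2k} = ∏_{j=1}^s ϑ_{α(n,ℓ_j)}(q^n, −z) / ϑ_{α(n,ℓ_j)}(q^n, −1). -/
/-- `ϑ_r(q,z) = ∑_{m ∈ ℤ+r} q^{m²/2} z^m` with `q = e^{2πiτ}`, `z = e^{2πiσ}`. -/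
noncomputable def thetaR (r : ℚ) (τ σ : ℂ) : ℂ :=
  ∑' k : ℤ, Complex.exp ((Real.pi : ℂ) * Complex.I * ((k : ℂ) + (r : ℂ)) ^ 2 * τ +
      2 * (Real.pi : ℂ) * Complex.I * ((k : ℂ) + (r : ℂ)) * σ)

/-- `α(n,ℓ) = ℓ/n - 1/2`. -/
def alphaQ (n ℓ : ℕ) : ℚ := (ℓ : ℚ) / (n : ℚ) - 1 / 2

/-- `A_{S,n,k}(q) = ∑_{0<m₁<⋯<m_k, mᵢ mod n ∈ S} q^{m₁+⋯+m_k}/∏(1-q^{mᵢ})²`,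
with `A_{S,n,0} = 1`. -/
noncomputable def ASnk (S : Finset ℕ) (n k : ℕ) (q : ℂ) : ℂ :=
  ∑' f : {f : Fin k → ℕ //
      StrictMono f ∧ (∀ i, 0 < f i) ∧ ∀ i, ∃ ℓ ∈ S, f i % n = ℓ % n},
    ∏ i, q ^ (f.1 i) / (1 - q ^ (f.1 i)) ^ 2


noncomputable def mmGb (Q : ℂ) : ℕ → ℕ → ℂ
  | 0, 0 => 1
  | 0, _ + 1 => 0
  | _ + 1, 0 => 1
  | M + 1, i + 1 => Q ^ (i + 1) * mmGb Q M (i + 1) + mmGb Q M i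

noncomputable def mmQp (Q : ℂ) (N : ℕ) : ℂ := ∏ j ∈ Finset.range N, (1 + -Q ^ (j + 1))

lemma mmGb_ss (Q : ℂ) (M i : ℕ) :
    mmGb Q (M + 1) (i + 1) = Q ^ (i + 1) * mmGb Q M (i + 1) + mmGb Q M i := by
  rw [mmGb]

lemma mmGb_zero_right (Q : ℂ) (M : ℕ) : mmGb Q M 0 = 1 := by
  cases M <;> simp [mmGb]

lemma mmGb_gt (Q : ℂ) (M : ℕ) : ∀ i, M < i → mmGb Q M i = 0 := by
  induction M with
  | zero => intro i hi; cases i with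
    | zero => omega
    | succ i => simp [mmGb]
  | succ M ih => intro i hi; cases i with
    | zero => omega
    | succ i => simp [mmGb, ih (i+1) (by omega), ih i (by omega)]

lemma mmQp_succ (Q : ℂ) (N : ℕ) : mmQp Q (N + 1) = mmQp Q N * (1 - Q ^ (N + 1)) := by
  simp [mmQp, Finset.prod_range_succ, sub_eq_add_neg]

lemma mmGb_self (Q : ℂ) (M : ℕ) : mmGb Q M M = 1 := by
  induction M with
  | zero => simp [mmGb]
  | succ M ih => simp [mmGb, ih, mmGb_gt]

lemma mmGb_mul (Q : ℂ) (M : ℕ) : ∀ i j, i + j = M →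
    mmGb Q M i * (mmQp Q i * mmQp Q j) = mmQp Q M := by
  induction M with
  | zero => intro i j h
            obtain ⟨rfl, rfl⟩ : i = 0 ∧ j = 0 := by omega
            simp [mmGb, mmQp]
  | succ M ih =>
    intro i j h
    cases i with
    | zero => 
      obtain rfl : j = M + 1 := by omega
      simp [mmGb, mmQp]
    | succ i =>
      cases j with
      | zero => 
        obtain rfl : i = M := by omega
        rw [mmGb_self]; simp [mmQp]
      | succ j =>
        have h1 := ih (i+1) j (by omega)
        have h2 := ih i (j+1) (by omega)
        obtain rfl : M = i + j + 1 := by omega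
        rw [mmGb_ss]
        rw [mmQp_succ] at h1 h2
        rw [mmQp_succ Q i, mmQp_succ Q j, mmQp_succ Q (i+j+1)]
        linear_combination (Q^(i+1) * (1 - Q^(j+1))) * h1 + (1 - Q^(i+1)) * h2

lemma mmGb_prod (Q : ℂ) (M : ℕ) : ∀ x : ℂ, ∏ j ∈ Finset.range M, (1 + x * Q ^ j) =
    ∑ i ∈ Finset.range (M + 1), mmGb Q M i * Q ^ (i.choose 2) * x ^ i := by
  induction M with
  | zero => simp [mmGb]
  | succ M ih =>
    intro x
    rw [Finset.prod_range_succ']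
    have : ∏ k ∈ Finset.range M, (1 + x * Q ^ (k + 1)) =
        ∏ k ∈ Finset.range M, (1 + (x * Q) * Q ^ k) :=
      Finset.prod_congr rfl fun k _ => by ring
    rw [this, ih, Finset.sum_range_succ' _ (M + 1)]
    simp only [mmGb_ss, pow_zero, mul_one, Nat.choose_zero_succ, mmGb_zero_right]
    have e : ∀ i ∈ Finset.range (M+1), (Q ^ (i + 1) * mmGb Q M (i + 1) + mmGb Q M i) * Q ^ ((i+1).choose 2) * x ^ (i + 1) = mmGb Q M (i + 1) * Q ^ ((i+1).choose 2) * (x * Q) ^ (i+1) + x * (mmGb Q M i * Q ^ (i.choose 2) * (x * Q) ^ i) := by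
      intro i _
      have : (i+1).choose 2 = i + i.choose 2 := by
        rw [Nat.choose_succ_succ' i 1]; simp
      rw [this]; ring
    rw [Finset.sum_congr rfl e, Finset.sum_add_distrib, ← Finset.mul_sum]
    have e2 := Finset.sum_range_succ' (fun i => mmGb Q M i * Q ^ (i.choose 2) * (x * Q) ^ i) (M+1)
    rw [Finset.sum_range_succ, mmGb_gt Q M (M+1) (by omega)] at e2
    simp [mmGb_zero_right] at e2
    linear_combination e2

/-- finite Jacobi triple product -/
lemma mm_finite_jtp (p w : ℂ) (hp : p ≠ 0) (hw : w ≠ 0) (N : ℕ) :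
    ∏ j ∈ Finset.range N, ((1 + w * p ^ (2 * j + 1)) * (1 + w⁻¹ * p ^ (2 * j + 1))) =
    ∑ i ∈ Finset.range (2 * N + 1), mmGb (p ^ 2) (2 * N) i *
      (p ^ (((i : ℤ) - N) ^ 2).toNat * w ^ ((i : ℤ) - N)) := by
  have h := mmGb_prod (p ^ 2) (2 * N) (w * p * (p ^ (2 * N))⁻¹)
  have hl : ∏ j ∈ Finset.range (2 * N), (1 + w * p * (p ^ (2 * N))⁻¹ * (p ^ 2) ^ j) =
      (w ^ N * (p ^ (N ^ 2))⁻¹) * ∏ j ∈ Finset.range N, ((1 + w * p ^ (2 * j + 1)) * (1 + w⁻¹ * p ^ (2 * j + 1))) := by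
    rw [two_mul, Finset.prod_range_add, Finset.prod_mul_distrib]
    have h1 : ∀ x ∈ Finset.range N, (1 + w * p * (p ^ (N + N))⁻¹ * (p ^ 2) ^ (N + x)) = 1 + w * p ^ (2 * x + 1) := by
      intro x _
      field_simp
      ring
    rw [Finset.prod_congr rfl h1, ← Finset.prod_range_reflect]
    have h2 : ∀ x ∈ Finset.range N, 1 + w * p * (p ^ (N + N))⁻¹ * (p ^ 2) ^ (N - 1 - x) =
       (w * (p ^ (2 * x + 1))⁻¹) * (1 + w⁻¹ * p ^ (2 * x + 1)) := by
      intro x hx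
      rw [Finset.mem_range] at hx
      obtain ⟨y, rfl⟩ := Nat.exists_eq_add_of_lt hx
      rw [show x + y + 1 - 1 - x = y by omega]
      field_simp
      ring
    rw [Finset.prod_congr rfl h2, Finset.prod_mul_distrib]
    have h3 : ∏ x ∈ Finset.range N, (w * (p ^ (2 * x + 1))⁻¹) = w ^ N * (p ^ (N ^ 2))⁻¹ := by
      clear h h1 h2
      induction N with
      | zero => simp
      | succ N ih => rw [Finset.prod_range_succ, ih]; field_simp; ring
    rw [h3]; ring
  rw [hl] at h
  have hne : w ^ N * (p ^ (N ^ 2))⁻¹ ≠ 0 := by positivity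
  apply mul_left_cancel₀ hne
  rw [h, Finset.mul_sum]
  refine Finset.sum_congr rfl fun i _ => ?_
  have hz : ∀ m : ℕ, p ^ m = p ^ (m : ℤ) := fun m => (zpow_natCast _ _).symm
  have hzw : ∀ m : ℕ, w ^ m = w ^ (m : ℤ) := fun m => (zpow_natCast _ _).symm
  have e1 : (p ^ 2) ^ (i.choose 2) * (w * p * (p ^ (2 * N))⁻¹) ^ i =
     p ^ ((i:ℤ)^2 - 2 * N * i) * w ^ (i : ℤ) := by
    rw [mul_pow, mul_pow, ← pow_mul, inv_pow, ← pow_mul, hzw, hz, hz, hz, ← zpow_neg]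
    have : 2 * (i.choose 2 : ℤ) = i * (i - 1) := by
      have := Nat.choose_two_right i
      have h2 := Nat.div_mul_cancel (Nat.even_mul_pred_self i).two_dvd
      rw [← this] at h2
      cases i with
      | zero => simp
      | succ i => push_cast; simp at h2; push_cast [← @Nat.cast_inj ℤ] at h2; linarith
    have e : (i:ℤ)^2 - 2 * N * i = ((2 * i.choose 2 : ℕ) : ℤ) + ((i : ℤ) + -((2 * N * i : ℕ) : ℤ)) := by
      push_cast; rw [this]; ring
    rw [e, zpow_add₀ hp, zpow_add₀ hp]; ring
  rw [mul_assoc, e1]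
  have e2 : w ^ N * (p ^ (N ^ 2))⁻¹ * (p ^ (((i : ℤ) - N) ^ 2).toNat * w ^ ((i : ℤ) - N)) = p ^ ((i:ℤ)^2 - 2 * N * i) * w ^ (i : ℤ) := by
    rw [hz, hz, hzw, Int.toNat_of_nonneg (sq_nonneg _), ← zpow_neg]
    have e : (i:ℤ)^2 - 2 * N * i = -((N ^ 2 : ℕ) : ℤ) + ((i:ℤ) - N)^2 := by push_cast; ring
    rw [e, zpow_add₀ hp]
    have e' : (i : ℤ) = N + ((i : ℤ) - N) := by ring
    conv_rhs => rw [e', zpow_add₀ hw]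
    ring_nf
  linear_combination (-mmGb (p^2) (2*N) i) * e2

open Filter Topology in
lemma mm_qp_tendsto (Q : ℂ) (hQ : ‖Q‖ < 1) :
    ∃ L : ℂ, L ≠ 0 ∧ Tendsto (mmQp Q) atTop (𝓝 L) := by
  have hs : Summable (fun j : ℕ => ‖-Q ^ (j + 1)‖) := by
    simp only [norm_neg, norm_pow]
    exact (summable_nat_add_iff 1).mpr (summable_geometric_of_lt_one (norm_nonneg _) hQ)
  refine ⟨∏' j : ℕ, (1 + -Q ^ (j + 1)), ?_, ?_⟩
  · apply tprod_one_add_ne_zero_of_summable _ hs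
    intro i h
    have h1 : Q ^ (i+1) = 1 := by linear_combination -h
    have h2 : ‖Q‖ ^ (i+1) = 1 := by rw [← norm_pow, h1, norm_one]
    have := pow_lt_one₀ (norm_nonneg Q) hQ (Nat.succ_ne_zero i)
    simp at this; linarith
  · exact (multipliable_one_add_of_summable hs).hasProd.tendsto_prod_nat

lemma mm_qp_ne (Q : ℂ) (hQ : ‖Q‖ < 1) (N : ℕ) : mmQp Q N ≠ 0 := by
  refine Finset.prod_ne_zero_iff.mpr fun i _ h => ?_
  have h1 : Q ^ (i+1) = 1 := by linear_combination -h
  have h2 : ‖Q‖ ^ (i+1) = 1 := by rw [← norm_pow, h1, norm_one]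
  have := pow_lt_one₀ (norm_nonneg Q) hQ (Nat.succ_ne_zero i)
  simp at this; linarith

lemma mmGb_eq (Q : ℂ) (hQ : ‖Q‖ < 1) (i j : ℕ) :
    mmGb Q (i + j) i = mmQp Q (i + j) * (mmQp Q i)⁻¹ * (mmQp Q j)⁻¹ := by
  have h := mmGb_mul Q _ i j rfl
  have h1 := mm_qp_ne Q hQ i
  have h2 := mm_qp_ne Q hQ j
  field_simp
  linear_combination h

open Filter Topology in
lemma mmGb_bdd (Q : ℂ) (hQ : ‖Q‖ < 1) : ∃ B : ℝ, 0 ≤ B ∧ ∀ M i, ‖mmGb Q M i‖ ≤ B := by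
  obtain ⟨L, hL, ht⟩ := mm_qp_tendsto Q hQ
  obtain ⟨C, hC⟩ := ht.norm.bddAbove_range
  obtain ⟨D, hD⟩ := (ht.inv₀ hL).norm.bddAbove_range
  have hC' : ∀ n, ‖mmQp Q n‖ ≤ C := fun n => hC ⟨n, rfl⟩
  have hD' : ∀ n, ‖(mmQp Q n)⁻¹‖ ≤ D := fun n => hD ⟨n, rfl⟩
  have hC0 : 0 ≤ C := (norm_nonneg _).trans (hC' 0)
  have hD0 : 0 ≤ D := (norm_nonneg _).trans (hD' 0)
  refine ⟨C * D * D, by positivity, fun M i => ?_⟩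
  by_cases h : M < i
  · rw [mmGb_gt Q M i h, norm_zero]; positivity
  · obtain ⟨j, rfl⟩ := Nat.exists_eq_add_of_le (not_lt.mp h)
    rw [mmGb_eq Q hQ, norm_mul, norm_mul]
    gcongr
    · exact hC' _
    · exact hD' _
    · exact hD' _

open Filter Topology Complex in
/-- Jacobi triple product, up to a nonzero constant depending only on τ. -/
lemma mm_jtp (τ : ℂ) (hτ : 0 < τ.im) : ∃ L : ℂ, L ≠ 0 ∧ ∀ z : ℂ,
    Tendsto (fun N : ℕ => ∏ j ∈ Finset.range N,
      ((1 + cexp (2 * Real.pi * I * z) * cexp (Real.pi * I * τ) ^ (2 * j + 1)) *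
       (1 + (cexp (2 * Real.pi * I * z))⁻¹ * cexp (Real.pi * I * τ) ^ (2 * j + 1)))) atTop
      (𝓝 (L * jacobiTheta₂ z τ)) := by
  set p := cexp (Real.pi * I * τ) with hp
  have hp1 : ‖p‖ < 1 := by
    rw [hp, norm_exp]
    simp
    positivity
  have hQ : ‖p ^ 2‖ < 1 := by
    rw [norm_pow]; exact pow_lt_one₀ (norm_nonneg _) hp1 two_ne_zero
  obtain ⟨L, hL, ht⟩ := mm_qp_tendsto _ hQ
  obtain ⟨B, hB0, hB⟩ := mmGb_bdd _ hQ
  refine ⟨L⁻¹, inv_ne_zero hL, fun z => ?_⟩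
  set w := cexp (2 * Real.pi * I * z) with hw
  let G : ℕ → ℤ → ℂ := fun N k => if -(N:ℤ) ≤ k then mmGb (p^2) (2*N) (k + N).toNat else 0
  have hterm : ∀ k : ℤ, p ^ (k ^ 2).toNat * w ^ k = jacobiTheta₂_term k z τ := by
    intro k
    rw [jacobiTheta₂_term, hp, hw, ← Complex.exp_nat_mul, ← Complex.exp_int_mul, ← Complex.exp_add]
    congr 1
    have : (((k^2).toNat : ℕ) : ℂ) = (k:ℂ)^2 := by
      have := Int.toNat_of_nonneg (sq_nonneg k)
      have h2 := congrArg (Int.cast : ℤ → ℂ) this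
      push_cast at h2; exact h2
    rw [this]; ring
  have hprod : ∀ N : ℕ, ∏ j ∈ Finset.range N, ((1 + w * p ^ (2 * j + 1)) * (1 + w⁻¹ * p ^ (2 * j + 1)))
      = ∑' k : ℤ, G N k * jacobiTheta₂_term k z τ := by
    intro N
    rw [mm_finite_jtp p w (Complex.exp_ne_zero _) (Complex.exp_ne_zero _) N]
    let e : ℕ ↪ ℤ := ⟨fun i => (i:ℤ) - N, fun a b h => by simpa using h⟩
    have he : ∀ i : ℕ, e i = (i : ℤ) - N := fun _ => rfl
    rw [tsum_eq_sum (s := (Finset.range (2*N+1)).map e)]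
    · rw [Finset.sum_map]
      refine Finset.sum_congr rfl fun i _ => ?_
      rw [hterm]
      simp only [he]
      simp [G]
    · intro k hk
      simp only [G]
      split_ifs with h
      · rw [mmGb_gt, zero_mul]
        by_contra hc
        apply hk
        rw [Finset.mem_map]
        refine ⟨(k+N).toNat, ?_, ?_⟩
        · rw [Finset.mem_range]; omega
        · rw [he]; omega
      · simp
  simp_rw [hprod]
  rw [jacobiTheta₂, ← tsum_mul_left]
  have hsum : Summable (fun k : ℤ => jacobiTheta₂_term k z τ) :=
    (summable_jacobiTheta₂_term_iff z τ).mpr hτ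
  refine tendsto_tsum_of_dominated_convergence (bound := fun k => B * ‖jacobiTheta₂_term k z τ‖)
    (hsum.norm.mul_left B) ?_ ?_
  · intro k
    refine Tendsto.mul_const _ ?_
    have h1 : Tendsto (fun N : ℕ => mmQp (p^2) (2*N)) atTop (𝓝 L) :=
      ht.comp (tendsto_id.const_mul_atTop' (by norm_num : 0 < 2))
    have hn : ∀ k : ℤ, Tendsto (fun N : ℕ => (k + N).toNat) atTop atTop := by
      intro k
      rw [tendsto_atTop]
      intro b
      filter_upwards [eventually_ge_atTop (k.natAbs + b)] with N hN
      omega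
    have h2 := (ht.comp (hn k)).inv₀ hL
    have h3 := (ht.comp (hn (-k))).inv₀ hL
    have h4 := (h1.mul h2).mul h3
    have : L * L⁻¹ * L⁻¹ = L⁻¹ := by field_simp
    rw [this] at h4
    refine h4.congr' ?_
    filter_upwards [eventually_ge_atTop k.natAbs] with N hN
    simp only [G, Function.comp]
    rw [if_pos (by omega), ← show (k + N).toNat + (-k+N).toNat = 2 * N by omega, mmGb_eq _ hQ]
  · refine Eventually.of_forall fun N k => ?_
    rw [norm_mul]
    gcongr
    simp only [G]
    split_ifs
    · exact hB _ _
    · simpa using hB0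

lemma mm_card_tsum (F : ℕ → ℂ) (P : ℕ → Prop) (hF : ∀ m, ¬ P m → F m = 0) (k : ℕ) :
    ∑' f : {f : Fin k → ℕ // StrictMono f ∧ ∀ i, P (f i)}, ∏ i, F (f.1 i) =
    ∑' s : (Finset.card : Finset ℕ → ℕ) ⁻¹' {k}, ∏ m ∈ s.1, F m := by
  let g : {f : Fin k → ℕ // StrictMono f ∧ ∀ i, P (f i)} →
      ((Finset.card : Finset ℕ → ℕ) ⁻¹' {k}) := fun f =>
    ⟨Finset.univ.map ⟨f.1, f.2.1.injective⟩, by simp⟩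
  have hg : Function.Injective g := by
    intro f f' h
    have h1 : Finset.univ.map ⟨f.1, f.2.1.injective⟩ = Finset.univ.map ⟨f'.1, f'.2.1.injective⟩ :=
      congrArg Subtype.val h
    apply Subtype.ext
    have hc : (Finset.univ.map ⟨f.1, f.2.1.injective⟩).card = k := by simp
    have a1 := Finset.orderEmbOfFin_unique hc (f := f.1) (fun x => by simp) f.2.1
    have a2 := Finset.orderEmbOfFin_unique hc (f := f'.1) (fun x => by rw [h1]; simp) f'.2.1
    rw [a1, a2]
  have := hg.tsum_eq (f := fun s : ((Finset.card : Finset ℕ → ℕ) ⁻¹' {k}) => ∏ m ∈ s.1, F m) ?_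
  · rw [← this]
    refine tsum_congr fun f => ?_
    simp [g]
  · intro s hs
    rw [Function.mem_support] at hs
    have hs' := Finset.prod_ne_zero_iff.mp hs
    refine ⟨⟨s.1.orderEmbOfFin s.2, (s.1.orderEmbOfFin s.2).strictMono, fun i => ?_⟩, ?_⟩
    · by_contra hc
      exact hs' _ (Finset.orderEmbOfFin_mem s.1 s.2 i) (hF _ hc)
    · apply Subtype.ext
      ext m
      simp only [g, Finset.mem_map, Finset.mem_univ, true_and, Function.Embedding.coeFn_mk]
      have := Finset.range_orderEmbOfFin s.1 s.2
      rw [← Finset.mem_coe, ← this]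
      rfl

lemma mm_lhs (S : Finset ℕ) (n : ℕ) (q x : ℂ) (hP : ∀ m, (0 < m ∧ ∃ ℓ ∈ S, m % n = ℓ % n) ↔ m % n ∈ S)
    (F : ℕ → ℂ) (hF : ∀ m, F m = if m % n ∈ S then -(x ^ 2 * (q ^ m / (1 - q ^ m) ^ 2)) else 0)
    (hs : Summable (fun m => ‖F m‖)) :
    ∑' k : ℕ, (-1 : ℂ) ^ k * ASnk S n k q * x ^ (2 * k) = ∑' s : Finset ℕ, ∏ m ∈ s, F m := by
  have h := (summable_finsetProd_of_summable_norm hs).hasSum.tsum_fiberwise Finset.card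
  rw [← h.tsum_eq]
  refine tsum_congr fun k => ?_
  rw [← mm_card_tsum F (fun m => m % n ∈ S) (fun m hm => by rw [hF, if_neg hm])]
  rw [ASnk, mul_comm, ← mul_assoc, ← tsum_mul_left]
  let e : {f : Fin k → ℕ // StrictMono f ∧ (∀ i, 0 < f i) ∧ ∀ i, ∃ ℓ ∈ S, f i % n = ℓ % n} ≃
      {f : Fin k → ℕ // StrictMono f ∧ ∀ i, f i % n ∈ S} :=
    Equiv.subtypeEquivRight fun f => by
      rw [← forall_and]; simp_rw [hP]
  rw [← e.tsum_eq]
  refine tsum_congr fun f => ?_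
  have hf := (e f).2.2
  have : ∀ i ∈ Finset.univ, F ((e f).1 i) = -(x^2) * (q ^ (f.1 i) / (1 - q ^ (f.1 i)) ^ 2) := by
    intro i _
    rw [hF, if_pos (hf i)]
    show -(x ^ 2 * (q ^ (f.1 i) / (1 - q ^ (f.1 i)) ^ 2)) = _
    ring
  rw [Finset.prod_congr rfl this, Finset.prod_mul_distrib, Finset.prod_const, Finset.card_univ,
    Fintype.card_fin, neg_pow (x ^ 2), ← pow_mul]
  ring

lemma mm_one_sub_ne (q : ℂ) (hq : ‖q‖ < 1) (m : ℕ) (hm : m ≠ 0) : 1 - q ^ m ≠ 0 := by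
  intro h
  have h1 : q ^ m = 1 := by linear_combination -h
  have h2 : ‖q‖ ^ m = 1 := by rw [← norm_pow, h1, norm_one]
  have := pow_lt_one₀ (norm_nonneg q) hq hm
  linarith

lemma mm_summable (S : Finset ℕ) (n : ℕ) (q x : ℂ) (hq : ‖q‖ < 1) (h0 : 0 ∉ S)
    (F : ℕ → ℂ) (hF : ∀ m, F m = if m % n ∈ S then -(x ^ 2 * (q ^ m / (1 - q ^ m) ^ 2)) else 0) :
    Summable (fun m => ‖F m‖) := by
  have hg := (summable_geometric_of_lt_one (norm_nonneg _) hq).mul_left (‖x‖^2 / (1 - ‖q‖)^2)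
  refine Summable.of_nonneg_of_le (fun _ => norm_nonneg _) (fun m => ?_) hg
  rw [hF]
  have hpos : 0 < 1 - ‖q‖ := by linarith
  split_ifs with h
  · have hm : m ≠ 0 := by rintro rfl; simp at h; exact h0 h
    rw [norm_neg, norm_mul, norm_div, norm_pow, norm_pow, norm_pow]
    have h1 : 1 - ‖q‖ ≤ ‖1 - q ^ m‖ := by
      have := norm_sub_norm_le (1:ℂ) (q^m)
      rw [norm_one, norm_pow] at this
      have h3 := pow_le_of_le_one (norm_nonneg q) hq.le hm
      linarith
    rw [mul_div_assoc', div_mul_eq_mul_div]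
    gcongr
  · rw [norm_zero]; positivity

open Filter Topology in
lemma mm_prod_ne (q : ℂ) (hq : ‖q‖ < 1) (n a : ℕ) (hn : n ≠ 0) (ha : a ≠ 0) :
    ∃ L : ℂ, L ≠ 0 ∧ Tendsto (fun N : ℕ => ∏ j ∈ Finset.range N, (1 - q ^ (n * j + a))) atTop (𝓝 L) := by
  have hs : Summable (fun j : ℕ => ‖-q ^ (n * j + a)‖) := by
    simp only [norm_neg, norm_pow]
    refine Summable.of_nonneg_of_le (fun _ => by positivity) (fun j => ?_)
      (summable_geometric_of_lt_one (norm_nonneg _) hq)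
    apply pow_le_pow_of_le_one (norm_nonneg _) hq.le
    have := Nat.le_mul_of_pos_left j (Nat.pos_of_ne_zero hn)
    omega
  refine ⟨∏' j : ℕ, (1 + -q ^ (n * j + a)), ?_, ?_⟩
  · apply tprod_one_add_ne_zero_of_summable _ hs
    intro i
    rw [← sub_eq_add_neg]
    exact mm_one_sub_ne q hq _ (by omega)
  · simp only [sub_eq_add_neg]
    exact (multipliable_one_add_of_summable hs).hasProd.tendsto_prod_nat

open Complex in
lemma mm_thetaR (r : ℚ) (τ σ : ℂ) :
    thetaR r τ σ = cexp (Real.pi * I * r ^ 2 * τ + 2 * Real.pi * I * r * σ) *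
      jacobiTheta₂ (σ + r * τ) τ := by
  rw [thetaR, jacobiTheta₂, ← tsum_mul_left]
  refine tsum_congr fun k => ?_
  rw [jacobiTheta₂_term, ← Complex.exp_add]
  congr 1
  ring

open Filter Topology Complex in
lemma mm_ratio (n ℓ : ℕ) (hℓ : ℓ ≠ 0) (hℓn : ℓ < n) (τ : ℂ) (hτ : 0 < τ.im) (σ q z : ℂ)
    (hq : q = cexp (2 * Real.pi * I * τ)) (hz : z = cexp (2 * Real.pi * I * σ)) :
    Tendsto (fun N : ℕ => ∏ j ∈ Finset.range N,
      (((1 - z * q ^ (n * j + ℓ)) * (1 - z⁻¹ * q ^ (n * j + (n - ℓ)))) /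
       ((1 - q ^ (n * j + ℓ)) * (1 - q ^ (n * j + (n - ℓ)))))) atTop
      (𝓝 (cexp (-(2 * Real.pi * I * (alphaQ n ℓ : ℚ) * σ)) *
        (thetaR (alphaQ n ℓ) ((n : ℂ) * τ) (σ + 1/2) /
        thetaR (alphaQ n ℓ) ((n : ℂ) * τ) (1/2)))) := by
  have hn0 : (n : ℂ) ≠ 0 := by
    have : n ≠ 0 := by omega
    exact_mod_cast this
  have hqn : ‖q‖ < 1 := by
    rw [hq, norm_exp]
    simp
    positivity
  have hnτ : 0 < ((n : ℂ) * τ).im := by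
    have : 0 < n := by omega
    simp
    positivity
  obtain ⟨L, hL, hJ⟩ := mm_jtp ((n : ℂ) * τ) hnτ
  have key : ∀ σ : ℂ, Tendsto (fun N : ℕ => ∏ j ∈ Finset.range N,
      ((1 - cexp (2 * Real.pi * I * σ) * q ^ (n * j + ℓ)) *
       (1 - (cexp (2 * Real.pi * I * σ))⁻¹ * q ^ (n * j + (n - ℓ))))) atTop
      (𝓝 (L * jacobiTheta₂ (σ + 1/2 + (alphaQ n ℓ : ℚ) * ((n : ℂ) * τ)) ((n : ℂ) * τ))) := by
    intro σ
    refine (hJ _).congr fun N => Finset.prod_congr rfl fun j _ => ?_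
    have hm1 : (-1 : ℂ) = cexp (Real.pi * I) := exp_pi_mul_I.symm
    have hm2 : (-1 : ℂ) = cexp (-(Real.pi * I)) := by rw [Complex.exp_neg, exp_pi_mul_I]; norm_num
    congr 1
    · rw [sub_eq_add_neg, ← neg_one_mul (cexp (2 * Real.pi * I * σ) * _), hm1, hq,
        ← Complex.exp_nat_mul, ← Complex.exp_nat_mul, ← Complex.exp_add, ← Complex.exp_add,
        ← Complex.exp_add]
      congr 2
      simp only [alphaQ]
      push_cast
      field_simp
      ring
    · rw [sub_eq_add_neg, ← neg_one_mul ((cexp (2 * Real.pi * I * σ))⁻¹ * _), hm2, hq,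
        ← Complex.exp_nat_mul, ← Complex.exp_nat_mul, ← Complex.exp_neg, ← Complex.exp_neg,
        ← Complex.exp_add, ← Complex.exp_add, ← Complex.exp_add]
      congr 2
      simp only [alphaQ]
      push_cast [Nat.cast_sub hℓn.le]
      field_simp
      ring
  have k1 := key σ
  have k0 := key 0
  simp only [mul_zero, Complex.exp_zero, inv_one, one_mul, zero_add] at k0
  obtain ⟨L1, hL1, t1⟩ := mm_prod_ne q hqn n ℓ (by omega) hℓ
  obtain ⟨L2, hL2, t2⟩ := mm_prod_ne q hqn n (n - ℓ) (by omega) (by omega)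
  have t12 := t1.mul t2
  simp only [← Finset.prod_mul_distrib] at t12
  have hlim := tendsto_nhds_unique k0 t12
  have hne : L * jacobiTheta₂ (1/2 + (alphaQ n ℓ : ℚ) * ((n : ℂ) * τ)) ((n : ℂ) * τ) ≠ 0 := by
    rw [hlim]; exact mul_ne_zero hL1 hL2
  have k2 := k1.div k0 hne
  rw [hz]
  have hfin : cexp (-(2 * Real.pi * I * (alphaQ n ℓ : ℚ) * σ)) *
        (thetaR (alphaQ n ℓ) ((n : ℂ) * τ) (σ + 1/2) /
        thetaR (alphaQ n ℓ) ((n : ℂ) * τ) (1/2)) =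
      L * jacobiTheta₂ (σ + 1/2 + (alphaQ n ℓ : ℚ) * ((n : ℂ) * τ)) ((n : ℂ) * τ) /
      (L * jacobiTheta₂ (1/2 + (alphaQ n ℓ : ℚ) * ((n : ℂ) * τ)) ((n : ℂ) * τ)) := by
    rw [mm_thetaR, mm_thetaR]
    have hJ0 := right_ne_zero_of_mul hne
    generalize jacobiTheta₂ (σ + 1/2 + (alphaQ n ℓ : ℚ) * ((n : ℂ) * τ)) ((n : ℂ) * τ) = X at *
    generalize jacobiTheta₂ (1/2 + (alphaQ n ℓ : ℚ) * ((n : ℂ) * τ)) ((n : ℂ) * τ) = Y at *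
    generalize ((alphaQ n ℓ : ℚ) : ℂ) = r
    rw [mul_div_mul_comm, ← Complex.exp_sub, ← mul_assoc, ← Complex.exp_add, mul_div_mul_left _ _ hL]
    have : -(2 * Real.pi * I * r * σ) + (Real.pi * I * r ^ 2 * (n * τ) + 2 * Real.pi * I * r * (σ + 1 / 2) -
      (Real.pi * I * r ^ 2 * (n * τ) + 2 * Real.pi * I * r * (1 / 2))) = 0 := by ring
    rw [this, Complex.exp_zero, one_mul]
  rw [hfin]
  refine k2.congr fun N => ?_
  rw [Pi.div_apply, ← Finset.prod_div_distrib]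

/-- for `n ≥ 1` and a symmetric `S ⊆ {1,…,n}` with `n ∉ S`, with
`x = z^{1/2} - z^{-1/2}`, `z = e^{2πiσ}`, `q = e^{2πiτ}`:
`∑_{k≥0} (-1)^k A_{S,n,k}(q) x^{2k} = ∏_{ℓ∈S} ϑ_{α(n,ℓ)}(qⁿ,-z)/ϑ_{α(n,ℓ)}(qⁿ,-1)`
(here `-z = e^{2πi(σ+1/2)}` and `-1 = e^{2πi·(1/2)}`). -/
theorem macmahonA_theta_product (n : ℕ) (hn : 1 ≤ n) (S : Finset ℕ)
    (hS : S ⊆ Finset.Icc 1 n) (hnS : n ∉ S) (hsym : ∀ ℓ ∈ S, n - ℓ ∈ S)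
    (τ σ : ℂ) (hτ : 0 < τ.im) :
    (∑' k : ℕ, (-1 : ℂ) ^ k *
        ASnk S n k (Complex.exp (2 * (Real.pi : ℂ) * Complex.I * τ)) *
        (Complex.exp ((Real.pi : ℂ) * Complex.I * σ) -
          Complex.exp (-((Real.pi : ℂ) * Complex.I * σ))) ^ (2 * k)) =
      ∏ ℓ ∈ S, thetaR (alphaQ n ℓ) ((n : ℂ) * τ) (σ + 1/2) /
        thetaR (alphaQ n ℓ) ((n : ℂ) * τ) (1/2) := by
  classical
  have hlt : ∀ ℓ ∈ S, ℓ ≠ 0 ∧ ℓ < n := by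
    intro ℓ h
    have h1 := Finset.mem_Icc.mp (hS h)
    have h2 : ℓ ≠ n := fun e => hnS (e ▸ h)
    omega
  have h0 : 0 ∉ S := fun h => (hlt 0 h).1 rfl
  set q := Complex.exp (2 * (Real.pi : ℂ) * Complex.I * τ) with hq
  set z := Complex.exp (2 * (Real.pi : ℂ) * Complex.I * σ) with hz
  set x := (Complex.exp ((Real.pi : ℂ) * Complex.I * σ) -
          Complex.exp (-((Real.pi : ℂ) * Complex.I * σ))) with hx
  have hqn : ‖q‖ < 1 := by
    rw [hq, Complex.norm_exp]
    simp
    positivity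
  have hz0 : z ≠ 0 := Complex.exp_ne_zero _
  have hx2 : x ^ 2 = z + z⁻¹ - 2 := by
    have e1 : z = Complex.exp ((Real.pi : ℂ) * Complex.I * σ) ^ 2 := by
      rw [hz, ← Complex.exp_nat_mul]; congr 1; push_cast; ring
    have hne := Complex.exp_ne_zero ((Real.pi : ℂ) * Complex.I * σ)
    rw [e1, hx, Complex.exp_neg]
    field_simp
    ring
  let F : ℕ → ℂ := fun m => if m % n ∈ S then -(x ^ 2 * (q ^ m / (1 - q ^ m) ^ 2)) else 0
  have hF : ∀ m, F m = if m % n ∈ S then -(x ^ 2 * (q ^ m / (1 - q ^ m) ^ 2)) else 0 := fun _ => rfl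
  have hP : ∀ m, (0 < m ∧ ∃ ℓ ∈ S, m % n = ℓ % n) ↔ m % n ∈ S := by
    intro m
    constructor
    · rintro ⟨_, ℓ, h, e⟩
      rw [e, Nat.mod_eq_of_lt (hlt ℓ h).2]; exact h
    · intro h
      refine ⟨?_, m % n, h, by simp⟩
      rcases Nat.eq_zero_or_pos m with rfl | hm
      · simp at h; exact absurd h h0
      · exact hm
  have hs := mm_summable S n q x hqn h0 F hF
  rw [mm_lhs S n q x hP F hF hs]
  have hprod := (hasProd_one_add_of_hasSum_prod
    (summable_finsetProd_of_summable_norm hs).hasSum).tendsto_prod_nat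
  have hA : Filter.Tendsto (fun N : ℕ => ∏ m ∈ Finset.range (n * N), (1 + F m)) Filter.atTop
      (nhds (∑' s : Finset ℕ, ∏ m ∈ s, F m)) :=
    hprod.comp (Filter.tendsto_id.const_mul_atTop' (by omega : 0 < n))
  have hB := tendsto_finsetProd S (fun ℓ h => mm_ratio n ℓ (hlt ℓ h).1 (hlt ℓ h).2 τ hτ σ q z hq hz)
  rw [Finset.prod_mul_distrib] at hB
  have hexp : ∏ ℓ ∈ S, Complex.exp (-(2 * Real.pi * Complex.I * (alphaQ n ℓ : ℚ) * σ)) = 1 := by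
    rw [← Complex.exp_sum]
    have hr : ∑ ℓ ∈ S, alphaQ n ℓ = 0 := by
      have h1 : ∑ ℓ ∈ S, alphaQ n ℓ = ∑ ℓ ∈ S, alphaQ n (n - ℓ) :=
        Finset.sum_nbij' (fun ℓ => n - ℓ) (fun ℓ => n - ℓ) hsym hsym
          (fun ℓ h => by have := hlt ℓ h; omega) (fun ℓ h => by have := hlt ℓ h; omega)
          (fun ℓ h => by have := hlt ℓ h; rw [Nat.sub_sub_self this.2.le])
      have h2 : ∑ ℓ ∈ S, alphaQ n (n - ℓ) = ∑ ℓ ∈ S, -alphaQ n ℓ := by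
        refine Finset.sum_congr rfl fun ℓ h => ?_
        have hn0 : (n : ℚ) ≠ 0 := by positivity
        simp only [alphaQ]
        rw [Nat.cast_sub (hlt ℓ h).2.le]
        field_simp
        ring
      rw [h2, Finset.sum_neg_distrib] at h1
      linarith
    have : ∑ ℓ ∈ S, -(2 * Real.pi * Complex.I * (alphaQ n ℓ : ℚ) * σ) =
        -(2 * Real.pi * Complex.I * ((∑ ℓ ∈ S, alphaQ n ℓ : ℚ) : ℂ) * σ) := by
      push_cast
      rw [Finset.mul_sum, Finset.sum_mul, Finset.sum_neg_distrib]
    rw [this, hr]; simp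
  rw [hexp, one_mul] at hB
  refine tendsto_nhds_unique hA (hB.congr fun N => ?_)
  rw [Finset.prod_comm]
  have hblock : ∀ N : ℕ, ∏ m ∈ Finset.range (n * N), (1 + F m) =
      ∏ j ∈ Finset.range N, ∏ r ∈ Finset.range n, (1 + F (n * j + r)) := by
    intro N
    induction N with
    | zero => simp
    | succ N ih => rw [Nat.mul_succ, Finset.prod_range_add, ih, Finset.prod_range_succ]
  rw [hblock]
  refine Finset.prod_congr rfl fun j _ => ?_
  have hsub : S ⊆ Finset.range n := fun ℓ h => Finset.mem_range.mpr (hlt ℓ h).2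
  rw [← Finset.prod_subset hsub (fun r hr hrS => by
    rw [hF, if_neg (by rwa [Nat.mul_add_mod, Nat.mod_eq_of_lt (Finset.mem_range.mp hr)]), add_zero])]
  have hrefl : ∀ f : ℕ → ℂ, ∏ ℓ ∈ S, f (n - ℓ) = ∏ ℓ ∈ S, f ℓ := fun f =>
    Finset.prod_nbij' (fun ℓ => n - ℓ) (fun ℓ => n - ℓ) hsym hsym
      (fun ℓ h => by have := hlt ℓ h; omega) (fun ℓ h => by have := hlt ℓ h; omega)
      (fun ℓ h => rfl)
  rw [Finset.prod_div_distrib, Finset.prod_mul_distrib, Finset.prod_mul_distrib,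
    hrefl (fun a => 1 - z⁻¹ * q ^ (n * j + a)), hrefl (fun a => 1 - q ^ (n * j + a)),
    ← Finset.prod_mul_distrib, ← Finset.prod_mul_distrib, ← Finset.prod_div_distrib]
  refine Finset.prod_congr rfl fun ℓ h => ?_
  rw [hF, if_pos (by rwa [Nat.mul_add_mod, Nat.mod_eq_of_lt (hlt ℓ h).2]), hx2]
  have hne := mm_one_sub_ne q hqn (n * j + ℓ) (by have := (hlt ℓ h).1; omega)
  generalize q ^ (n * j + ℓ) = y at *
  field_simp
  ring
end

section
/- Fix n ≥ 1 and a symmetric set S with n ∈ S, S = {n, ℓ_1,…,ℓ_s}. Then with x = z^{1/2} − z^{-1/2}: ∑_{k≥0} (−1)^k A_{S,n,k}(q) x^{2k+1} = −i · ϑ_{1/2}(q^n,−z) ∏_{j=1}^s ϑ_{α(n,ℓ_j)}(q^n,−z) / (η(q^n)³ ∏_{j=1}^s ϑ_{α(n,ℓ_j)}(q^n,−1)). -/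
/-- The Dedekind eta function `η(q) = q^{1/24} ∏_{m≥1}(1-qᵐ)`, with `q = e^{2πiτ}`. -/
noncomputable def etaQ (τ : ℂ) : ℂ :=
  Complex.exp (2 * (Real.pi : ℂ) * Complex.I * τ / 24) *
    ∏' m : ℕ, (1 - Complex.exp (2 * (Real.pi : ℂ) * Complex.I * τ) ^ (m + 1))

noncomputable def qP (q : ℂ) (j : ℕ) : ℂ := ∏ i ∈ Finset.range j, (1 - q ^ (i + 1))

lemma one_sub_pow_ne {q : ℂ} (hq : ‖q‖ < 1) {j : ℕ} (hj : j ≠ 0) : 1 - q ^ j ≠ 0 := by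
  intro h
  have h1 : q ^ j = 1 := (sub_eq_zero.mp h).symm
  have h2 : ‖q‖ ^ j < 1 := pow_lt_one₀ (norm_nonneg _) hq hj
  rw [← norm_pow, h1] at h2
  simp at h2

lemma qP_ne {q : ℂ} (hq : ‖q‖ < 1) (j : ℕ) : qP q j ≠ 0 :=
  Finset.prod_ne_zero_iff.mpr fun i _ => one_sub_pow_ne hq (Nat.succ_ne_zero i)

lemma qP_succ (q : ℂ) (j : ℕ) : qP q (j + 1) = qP q j * (1 - q ^ (j + 1)) :=
  Finset.prod_range_succ _ _

lemma qP_zero (q : ℂ) : qP q 0 = 1 := rfl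

/-- Gaussian binomial, zero outside range. -/
noncomputable def qB (q : ℂ) (M j : ℕ) : ℂ :=
  if j ≤ M then qP q M / (qP q j * qP q (M - j)) else 0

lemma qB_succ {q : ℂ} (hq : ‖q‖ < 1) (M j : ℕ) (hj : j ≤ M) :
    qB q (M + 1) (j + 1) = qB q M (j + 1) + q ^ (M - j) * qB q M j := by
  obtain ⟨d, rfl⟩ := Nat.exists_eq_add_of_le hj
  have e1 : j + d + 1 - (j + 1) = d := by omega
  have e2 : j + d - j = d := by omega
  rcases d with _ | d
  · simp only [qB, e1, e2, qP_zero]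
    have := qP_ne hq j
    have := qP_ne hq (j+1)
    simp only [add_zero, le_refl, if_true]
    rw [if_neg (by omega)]
    field_simp
    simp
  · have e3 : j + (d + 1) - (j + 1) = d := by omega
    simp only [qB, e1, e2, e3]
    rw [if_pos (by omega), if_pos (by omega), if_pos (by omega), qP_succ q (j + (d+1)), qP_succ q j,
      qP_succ q d]
    have := qP_ne hq j
    have := qP_ne hq d
    have := one_sub_pow_ne hq (Nat.succ_ne_zero j)
    have := one_sub_pow_ne hq (Nat.succ_ne_zero d)
    field_simp
    ring

lemma qB_zero {q : ℂ} (hq : ‖q‖ < 1) (M : ℕ) : qB q M 0 = 1 := by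
  simp [qB, qP_zero, div_self (qP_ne hq M)]

lemma qbinom_thm {q : ℂ} (hq : ‖q‖ < 1) (y : ℂ) (M : ℕ) :
    ∏ j ∈ Finset.range M, (1 + y * q ^ j) =
      ∑ j ∈ Finset.range (M + 1), qB q M j * q ^ (j.choose 2) * y ^ j := by
  induction M with
  | zero => simp [qB_zero hq]
  | succ M ih =>
    rw [Finset.prod_range_succ, ih, Finset.sum_range_succ' _ (M + 1), mul_add, mul_one]
    have h1 : ∀ j ∈ Finset.range (M + 1),
        qB q (M + 1) (j + 1) * q ^ ((j + 1).choose 2) * y ^ (j + 1) =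
        qB q M (j + 1) * q ^ ((j + 1).choose 2) * y ^ (j + 1) +
        qB q M j * q ^ (j.choose 2) * y ^ j * (y * q ^ M) := by
      intro j hj
      have hj' : j ≤ M := by simpa [Nat.lt_succ_iff] using hj
      rw [qB_succ hq M j hj']
      have : (j + 1).choose 2 = j + j.choose 2 := by
        rw [Nat.choose_succ_succ' j 1]; simp
      rw [this]
      obtain ⟨d, rfl⟩ := Nat.exists_eq_add_of_le hj'
      rw [show j + d - j = d by omega]
      ring
    rw [Finset.sum_congr rfl h1, Finset.sum_add_distrib, ← Finset.sum_mul]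
    have h2 := Finset.sum_range_succ' (fun j => qB q M j * q ^ (j.choose 2) * y ^ j) (M + 1)
    rw [Finset.sum_range_succ] at h2
    have h3 : qB q M (M + 1) = 0 := by simp [qB]
    rw [h3] at h2
    simp only [qB_zero hq, zero_mul, add_zero] at h2 ⊢
    rw [h2]
    ring

open Complex Real in
lemma norm_q_lt {τ : ℂ} (hτ : 0 < τ.im) : ‖cexp (2 * π * I * τ)‖ < 1 := by
  rw [Complex.norm_exp, Real.exp_lt_one_iff]
  have := mul_pos Real.pi_pos hτ
  simp
  linarith

open Complex Real in
lemma finite_jtp (z τ : ℂ) (hτ : 0 < τ.im) (N : ℕ) :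
    (∏ i ∈ Finset.range N, (1 + cexp (2 * π * I * z + π * I * τ) * cexp (2 * π * I * τ) ^ i)) *
    (∏ i ∈ Finset.range N,
      (1 + (cexp (2 * π * I * z + π * I * τ))⁻¹ * cexp (2 * π * I * τ) ^ (i + 1))) =
    ∑ j ∈ Finset.range (2 * N + 1), qB (cexp (2 * π * I * τ)) (2 * N) j *
      jacobiTheta₂_term ((j : ℤ) - N) z τ := by
  have hq : ‖cexp (2 * π * I * τ)‖ < 1 := norm_q_lt hτ
  set q := cexp (2 * π * I * τ) with hqd
  have hq0 : q ≠ 0 := exp_ne_zero _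
  set y := cexp (2 * π * I * z + π * I * τ) with hyd
  have hy0 : y ≠ 0 := exp_ne_zero _
  have h := qbinom_thm hq (y * (q ^ N)⁻¹) (2 * N)
  have h2 : ∏ j ∈ Finset.range (2 * N), (1 + (y * (q ^ N)⁻¹) * q ^ j) =
     (∏ i ∈ Finset.range N, (1 + y⁻¹ * q ^ (i + 1))) * (y ^ N * ∏ i ∈ Finset.range N, (q ^ (i+1))⁻¹) * 
      (∏ i ∈ Finset.range N, (1 + y * q ^ i)) := by
    rw [two_mul, Finset.prod_range_add]
    congr 1
    · rw [← Finset.prod_range_reflect]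
      have : y ^ N = ∏ i ∈ Finset.range N, y := by simp
      rw [this, ← Finset.prod_mul_distrib, ← Finset.prod_mul_distrib]
      refine Finset.prod_congr rfl fun i hi => ?_
      have hi : i < N := by simpa using hi
      obtain ⟨d, rfl⟩ := Nat.exists_eq_add_of_lt hi
      rw [show i + d + 1 - 1 - i = d by omega]
      field_simp
      ring
    · refine Finset.prod_congr rfl fun i hi => ?_
      rw [pow_add]
      field_simp
  rw [h2] at h
  have h3 : ∏ i ∈ Finset.range N, (q ^ (i+1))⁻¹ = cexp (- (π * I * τ * N * (N + 1))) := by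
    clear h h2
    induction N with
    | zero => simp
    | succ N ih =>
      rw [Finset.prod_range_succ, ih, hqd, ← Complex.exp_nat_mul, ← Complex.exp_neg, ← Complex.exp_add]
      push_cast
      ring_nf
  have hne : y ^ N * ∏ i ∈ Finset.range N, (q ^ (i+1))⁻¹ ≠ 0 := by
    rw [h3]; exact mul_ne_zero (pow_ne_zero _ hy0) (exp_ne_zero _)
  apply mul_left_cancel₀ hne
  have h4 : ∀ A B C : ℂ, C * (A * B) = B * C * A := by intros; ring
  rw [h4, h, h3, Finset.mul_sum]
  refine Finset.sum_congr rfl fun j _ => ?_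
  have h5 : ∀ A B C D : ℂ, B * D = C → A * B * D = A * C := by intros; subst_vars; ring
  have h6 : ∀ A B C : ℂ, C * (A * B) = A * (C * B) := by intros; ring
  rw [h6]
  apply h5
  have hc : ((j.choose 2 : ℕ) : ℂ) = j * (j - 1) / 2 := Nat.cast_choose_two ℂ j
  rw [mul_pow, inv_pow, ← pow_mul, jacobiTheta₂_term, hqd, hyd, ← Complex.exp_nat_mul,
    ← Complex.exp_nat_mul, ← Complex.exp_nat_mul, ← Complex.exp_nat_mul, ← Complex.exp_neg, ← Complex.exp_add,
    ← Complex.exp_add, ← Complex.exp_add, ← Complex.exp_add]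
  congr 1
  rw [hc]
  push_cast
  ring

lemma summ_geom {q : ℂ} (hq : ‖q‖ < 1) (c : ℂ) : Summable fun i : ℕ => ‖c * q ^ i‖ := by
  simp only [norm_mul, norm_pow]
  exact (summable_geometric_of_lt_one (norm_nonneg _) hq).mul_left _

lemma mult_geom {q : ℂ} (hq : ‖q‖ < 1) (c : ℂ) : Multipliable fun i : ℕ => 1 + c * q ^ i :=
  multipliable_one_add_of_summable (summ_geom hq c)

open Filter Topology in
lemma qP_tendsto {q : ℂ} (hq : ‖q‖ < 1) :
    Tendsto (qP q) atTop (𝓝 (∏' i : ℕ, (1 - q ^ (i + 1)))) ∧ ∏' i : ℕ, (1 - q ^ (i + 1)) ≠ 0 := by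
  have e : (fun i : ℕ => 1 - q ^ (i + 1)) = fun i : ℕ => 1 + (-q) * q ^ i := by
    ext i; ring
  constructor
  · have := mult_geom hq (-q)
    rw [← e] at this
    exact this.tendsto_prod_tprod_nat
  · rw [e]
    apply tprod_one_add_ne_zero_of_summable _ (summ_geom hq (-q))
    intro i
    rw [← congrFun e i]
    exact one_sub_pow_ne hq (Nat.succ_ne_zero i)

open Filter Topology in
lemma qB_bound {q : ℂ} (hq : ‖q‖ < 1) : ∃ C : ℝ, 0 ≤ C ∧ ∀ M j, ‖qB q M j‖ ≤ C := by
  obtain ⟨h1, h2⟩ := qP_tendsto hq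
  obtain ⟨A, hA⟩ := h1.norm.bddAbove_range
  obtain ⟨B, hB⟩ := (h1.inv₀ h2).norm.bddAbove_range
  have hA' : ∀ j, ‖qP q j‖ ≤ A := fun j => hA ⟨j, rfl⟩
  have hB' : ∀ j, ‖(qP q j)⁻¹‖ ≤ B := fun j => hB ⟨j, rfl⟩
  have hA0 : 0 ≤ A := (norm_nonneg _).trans (hA' 0)
  have hB0 : 0 ≤ B := (norm_nonneg _).trans (hB' 0)
  refine ⟨A * (B * B), by positivity, fun M j => ?_⟩
  unfold qB
  split_ifs
  · rw [div_eq_mul_inv, mul_inv, norm_mul, norm_mul]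
    gcongr
    exacts [hA' _, hB' _, hB' _]
  · simp; positivity

open Filter Topology in
lemma qB_tendsto {q : ℂ} (hq : ‖q‖ < 1) (k : ℤ) :
    Tendsto (fun N : ℕ => if -(N : ℤ) ≤ k then qB q (2 * N) (k + N).toNat else 0) atTop
      (𝓝 (∏' i : ℕ, (1 - q ^ (i + 1)))⁻¹) := by
  obtain ⟨h1, h2⟩ := qP_tendsto hq
  have ha : Tendsto (fun N : ℕ => 2 * N) atTop atTop :=
    tendsto_atTop_atTop.mpr fun b => ⟨b, fun a _ => by omega⟩
  have hb : Tendsto (fun N : ℕ => (k + N).toNat) atTop atTop :=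
    tendsto_atTop_atTop.mpr fun b => ⟨b + k.natAbs, fun a _ => by omega⟩
  have hc : Tendsto (fun N : ℕ => 2 * N - (k + N).toNat) atTop atTop :=
    tendsto_atTop_atTop.mpr fun b => ⟨b + k.natAbs, fun a _ => by omega⟩
  have := (h1.comp ha).div ((h1.comp hb).mul (h1.comp hc)) (mul_ne_zero h2 h2)
  have e : (∏' i : ℕ, (1 - q ^ (i + 1)))⁻¹ = (∏' i : ℕ, (1 - q ^ (i + 1))) /
    ((∏' i : ℕ, (1 - q ^ (i + 1))) * (∏' i : ℕ, (1 - q ^ (i + 1)))) := by field_simp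
  rw [e]
  refine this.congr' ?_
  filter_upwards [eventually_ge_atTop k.natAbs] with N hN
  rw [if_pos (by omega), qB, if_pos (by omega)]
  rfl

open Complex Real Filter Topology in
lemma jtp (z τ : ℂ) (hτ : 0 < τ.im) :
    jacobiTheta₂ z τ = (∏' i : ℕ, (1 - cexp (2 * π * I * τ) ^ (i + 1))) *
    ((∏' i : ℕ, (1 + cexp (2 * π * I * z + π * I * τ) * cexp (2 * π * I * τ) ^ i)) *
    (∏' i : ℕ,
      (1 + (cexp (2 * π * I * z + π * I * τ))⁻¹ * cexp (2 * π * I * τ) ^ (i + 1)))) := by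
  have hq := norm_q_lt hτ
  have hfin := finite_jtp z τ hτ
  set q := cexp (2 * π * I * τ) with hqd
  set y := cexp (2 * π * I * z + π * I * τ) with hyd
  obtain ⟨C, hC0, hC⟩ := qB_bound hq
  have hs : Summable fun k : ℤ => C * ‖jacobiTheta₂_term k z τ‖ :=
    (((summable_jacobiTheta₂_term_iff z τ).mpr hτ).norm).mul_left C
  have hlim := tendsto_tsum_of_dominated_convergence (𝓕 := atTop)
    (f := fun (N : ℕ) (k : ℤ) => (if -(N : ℤ) ≤ k then qB q (2 * N) (k + N).toNat else 0) *
      jacobiTheta₂_term k z τ) hs (fun k => (qB_tendsto hq k).mul_const _)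
      (Eventually.of_forall fun N k => by
        rw [norm_mul]
        gcongr
        split_ifs
        · exact hC _ _
        · simpa using hC0)
  rw [tsum_mul_left] at hlim
  have hprod := ((mult_geom hq y).tendsto_prod_tprod_nat).mul
    ((mult_geom hq (y⁻¹ * q)).tendsto_prod_tprod_nat)
  have e1 : ∀ i : ℕ, y⁻¹ * q * q ^ i = y⁻¹ * q ^ (i + 1) := fun i => by ring
  simp only [e1] at hprod
  have := tendsto_nhds_unique (hprod.congr fun N => ?_) hlim
  · rw [this, jacobiTheta₂, ← mul_assoc, mul_inv_cancel₀ (qP_tendsto hq).2, one_mul]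
  · rw [hfin N]
    rw [tsum_eq_sum (s := (Finset.range (2 * N + 1)).map
      ⟨fun j : ℕ => (j : ℤ) - N, fun a b h => by simpa using h⟩), Finset.sum_map]
    · refine Finset.sum_congr rfl fun j _ => ?_
      change _ = (if -(N : ℤ) ≤ (j : ℤ) - N then qB q (2 * N) ((j : ℤ) - N + N).toNat else 0) *
        jacobiTheta₂_term ((j : ℤ) - N) z τ
      simp
    · intro k hk
      simp only [Finset.mem_map, Finset.mem_range, not_exists,
        not_and] at hk
      split_ifs with h
      · have : _ → ((k + N).toNat : ℤ) - N ≠ k := hk (k + N).toNat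
        rw [qB, if_neg (by omega), zero_mul]
      · simp

def TT (S : Finset ℕ) (n m : ℕ) : Prop := 0 < m ∧ ∃ ℓ ∈ S, m % n = ℓ % n

noncomputable def toFS (S : Finset ℕ) (n : ℕ) : (Σ k : ℕ, {f : Fin k → ℕ //
      StrictMono f ∧ (∀ i, 0 < f i) ∧ ∀ i, ∃ ℓ ∈ S, f i % n = ℓ % n}) → Finset {m // TT S n m} :=
  fun p => Finset.univ.map ⟨fun i => ⟨p.2.1 i, p.2.2.2.1 i, p.2.2.2.2 i⟩, fun _ _ h =>
    p.2.2.1.injective (Subtype.mk.inj h)⟩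

lemma toFS_bij (S : Finset ℕ) (n : ℕ) : Function.Bijective (toFS S n) := by
  constructor
  · rintro ⟨k, f, hf⟩ ⟨k', g, hg⟩ h
    have hc := congrArg Finset.card h
    simp only [toFS, Finset.card_map, Finset.card_univ, Fintype.card_fin] at hc
    subst hc
    congr 1
    apply Subtype.ext
    have h2 : Set.range f = Set.range g := by
      have := congrArg (fun s : Finset {m // TT S n m} => (Subtype.val '' (s : Set {m // TT S n m}))) h
      simp only [toFS, Finset.coe_map, Finset.coe_univ, Set.image_univ, ← Set.range_comp] at this
      exact this
    exact (hf.1.range_inj hg.1).mp h2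
  · intro s
    refine ⟨⟨s.card, fun i => (s.orderEmbOfFin rfl i).1, ?_, ?_, ?_⟩, ?_⟩
    · intro a b h
      exact (s.orderEmbOfFin rfl).strictMono h
    · intro i; exact (s.orderEmbOfFin rfl i).2.1
    · intro i; exact (s.orderEmbOfFin rfl i).2.2
    · exact s.map_orderEmbOfFin_univ rfl

lemma lhs_prod (S : Finset ℕ) (n : ℕ) (w : ℕ → ℂ) (hw : Summable fun m => ‖w m‖) :
    ∑' k : ℕ, ∑' f : {f : Fin k → ℕ //
      StrictMono f ∧ (∀ i, 0 < f i) ∧ ∀ i, ∃ ℓ ∈ S, f i % n = ℓ % n}, ∏ i, w (f.1 i) =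
    ∏' m : {m // TT S n m}, (1 + w m) := by
  have h1 : Summable fun m : {m // TT S n m} => ‖w m‖ := hw.subtype {m | TT S n m}
  have h2 := summable_finsetProd_of_summable_norm h1
  rw [tprod_one_add h2]
  let e := Equiv.ofBijective _ (toFS_bij S n)
  rw [← e.tsum_eq]
  have h3 := e.summable_iff.mpr h2
  refine Eq.trans ?_ (Summable.tsum_sigma h3).symm
  refine tsum_congr fun k => tsum_congr fun f => ?_
  change _ = ∏ m ∈ toFS S n ⟨k, f⟩, w m
  rw [toFS, Finset.prod_map]
  rfl

lemma prod_split (S : Finset ℕ) (n : ℕ) (hn : 1 ≤ n) (hS : S ⊆ Finset.Icc 1 n)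
    (w : ℕ → ℂ) (hw : Summable fun m => ‖w m‖) :
    ∏' m : {m // TT S n m}, (1 + w m) = ∏ ℓ ∈ S, ∏' i : ℕ, (1 + w (n * i + ℓ)) := by
  have hS' : ∀ ℓ ∈ S, 1 ≤ ℓ ∧ ℓ ≤ n := fun ℓ h => Finset.mem_Icc.mp (hS h)
  let g : S × ℕ → {m // TT S n m} := fun p => ⟨n * p.2 + p.1, by
    have := hS' p.1 p.1.2
    refine ⟨by omega, p.1, p.1.2, by simp⟩⟩
  have hg : Function.Bijective g := by
    constructor
    · rintro ⟨⟨a, ha⟩, i⟩ ⟨⟨b, hb⟩, j⟩ h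
      have h : n * i + a = n * j + b := Subtype.mk.inj h
      have ha := hS' a ha
      have hb := hS' b hb
      have hij : i = j := by
        rcases lt_trichotomy i j with h' | h' | h'
        · have : n * (i + 1) ≤ n * j := Nat.mul_le_mul_left _ h'
          rw [mul_add] at this; omega
        · exact h'
        · have : n * (j + 1) ≤ n * i := Nat.mul_le_mul_left _ h'
          rw [mul_add] at this; omega
      subst hij
      have : a = b := by omega
      subst this
      rfl
    · rintro ⟨m, hm, ℓ, hℓ, h⟩
      have hb := hS' ℓ hℓ
      have hle : ℓ ≤ m := by
        by_contra hlt
        push Not at hlt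
        rw [Nat.mod_eq_of_lt (by omega : m < n)] at h
        rcases hb.2.lt_or_eq with h' | h'
        · rw [Nat.mod_eq_of_lt h'] at h; omega
        · subst h'; simp at h; omega
      obtain ⟨i, hi⟩ := (Nat.modEq_iff_dvd' hle).mp h.symm
      refine ⟨⟨⟨ℓ, hℓ⟩, i⟩, Subtype.ext ?_⟩
      change n * i + ℓ = m
      omega
  have h1 : Summable fun m : {m // TT S n m} => ‖w m‖ := hw.subtype {m | TT S n m}
  have h2 := (Equiv.ofBijective g hg).summable_iff.mpr h1
  rw [← (Equiv.ofBijective g hg).tprod_eq]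
  have h3 : Multipliable fun p : S × ℕ => 1 + w (n * p.2 + p.1) :=
    multipliable_one_add_of_summable h2
  change ∏' p : S × ℕ, (1 + w (n * p.2 + p.1)) = _
  rw [Multipliable.tprod_prod' h3, tprod_fintype, Finset.prod_coe_sort S (fun ℓ => ∏' i : ℕ, (1 + w (n * i + ℓ)))]
  intro ℓ
  refine multipliable_one_add_of_summable (hw.comp_injective (i := fun i : ℕ => n * i + (ℓ : ℕ)) ?_)
  intro a b h
  have : n * a = n * b := by simpa using h
  exact Nat.eq_of_mul_eq_mul_left hn this

/-- product helper -/
noncomputable def PP (q : ℂ) (n : ℕ) (w : ℂ) (a : ℕ) : ℂ := ∏' i : ℕ, (1 - w * q ^ (n * i + a))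

lemma pow_n_lt {q : ℂ} (hq : ‖q‖ < 1) {n : ℕ} (hn : 1 ≤ n) : ‖q ^ n‖ < 1 := by
  rw [norm_pow]; exact pow_lt_one₀ (norm_nonneg _) hq (by omega)

lemma PP_mult {q : ℂ} (hq : ‖q‖ < 1) {n : ℕ} (hn : 1 ≤ n) (w : ℂ) (a : ℕ) :
    Multipliable fun i : ℕ => (1 - w * q ^ (n * i + a)) :=
  (mult_geom (pow_n_lt hq hn) (-(w * q ^ a))).congr fun i => by rw [← pow_mul]; ring

lemma PP_ne {q : ℂ} (hq : ‖q‖ < 1) {n : ℕ} (hn : 1 ≤ n) (a : ℕ) (ha : 1 ≤ a) :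
    PP q n 1 a ≠ 0 := by
  have e : ∀ i : ℕ, (1 - 1 * q ^ (n * i + a)) = 1 + (-(q ^ a)) * (q ^ n) ^ i := fun i => by
    rw [← pow_mul]; ring
  unfold PP
  simp only [e]
  refine tprod_one_add_ne_zero_of_summable (fun i => ?_) (summ_geom (pow_n_lt hq hn) _)
  rw [← e, one_mul]
  exact one_sub_pow_ne hq (by omega)

lemma PP_zero {q : ℂ} (hq : ‖q‖ < 1) {n : ℕ} (hn : 1 ≤ n) (w : ℂ) :
    PP q n w 0 = (1 - w) * PP q n w n := by
  have h : Multipliable fun i : ℕ => (1 - w * q ^ (n * (i + 1) + 0)) :=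
    (PP_mult hq hn w n).congr fun i => by
      rw [show n * (i + 1) + 0 = n * i + n by ring]
  have h2 := tprod_eq_zero_mul' (f := fun i : ℕ => (1 - w * q ^ (n * i + 0))) h
  have h3 : ∏' i : ℕ, (1 - w * q ^ (n * (i + 1) + 0)) = PP q n w n :=
    tprod_congr fun i => by rw [show n * (i + 1) + 0 = n * i + n by ring]
  rw [h3] at h2
  rw [PP, h2, mul_zero, zero_add, pow_zero, mul_one]

lemma summ_w {q : ℂ} (hq : ‖q‖ < 1) (c : ℂ) :
    Summable fun j : ℕ => ‖c * (q ^ j / (1 - q ^ j) ^ 2)‖ := by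
  have h := ((summable_geometric_of_lt_one (norm_nonneg _) hq).mul_left (‖c‖ / (1 - ‖q‖) ^ 2))
  refine Summable.of_nonneg_of_le (fun _ => norm_nonneg _) (fun j => ?_) h
  have h0 : 0 < 1 - ‖q‖ := by linarith
  rcases Nat.eq_zero_or_pos j with rfl | hj
  · simp; positivity
  · have h1 : 1 - ‖q‖ ≤ ‖1 - q ^ j‖ := by
      have h2 : ‖q ^ j‖ ≤ ‖q‖ := by
        rw [norm_pow]; exact pow_le_of_le_one (norm_nonneg _) hq.le (by omega)
      have h3 := norm_sub_norm_le (1 : ℂ) (q ^ j)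
      rw [norm_one] at h3
      linarith
    rw [norm_mul, norm_div, norm_pow, norm_pow, div_mul_eq_mul_div, ← mul_div_assoc]
    gcongr

lemma W_eq {q : ℂ} (hq : ‖q‖ < 1) {n : ℕ} (hn : 1 ≤ n) (z : ℂ) (hz : z ≠ 0) (a : ℕ) (ha : 1 ≤ a)
    (c : ℂ) (hc : c = -(z + z⁻¹ - 2)) :
    (∏' i : ℕ, (1 + c * (q ^ (n * i + a) / (1 - q ^ (n * i + a)) ^ 2))) * (PP q n 1 a * PP q n 1 a)
      = PP q n z a * PP q n z⁻¹ a := by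
  have hm : Multipliable fun i : ℕ => (1 + c * (q ^ (n * i + a) / (1 - q ^ (n * i + a)) ^ 2)) := by
    refine multipliable_one_add_of_summable
      ((summ_w hq c).comp_injective (i := fun i : ℕ => n * i + a) ?_)
    intro a b h
    have : n * a = n * b := by simpa using h
    exact Nat.eq_of_mul_eq_mul_left hn this
  have h1 := PP_mult hq hn 1 a
  unfold PP
  rw [← h1.tprod_mul h1, ← hm.tprod_mul (h1.mul h1),
    ← (PP_mult hq hn z a).tprod_mul (PP_mult hq hn z⁻¹ a)]
  refine tprod_congr fun i => ?_
  have := one_sub_pow_ne hq (show n * i + a ≠ 0 by omega)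
  rw [hc]
  generalize q ^ (n * i + a) = Q at *
  field_simp
  ring

open Complex Real in
lemma theta_prod {n : ℕ} (hn : 1 ≤ n) (ℓ : ℕ) (hℓ : ℓ ≤ n) (τ σ : ℂ) (hτ : 0 < τ.im) :
    thetaR (alphaQ n ℓ) ((n : ℂ) * τ) (σ + 1/2) =
      cexp (π * I * (alphaQ n ℓ : ℂ) ^ 2 * (n * τ) + π * I * (alphaQ n ℓ : ℂ)) *
      cexp (2 * π * I * (alphaQ n ℓ : ℂ) * σ) *
      (PP (cexp (2 * π * I * τ)) n 1 n * (PP (cexp (2 * π * I * τ)) n (cexp (2 * π * I * σ)) ℓ *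
        PP (cexp (2 * π * I * τ)) n (cexp (2 * π * I * σ))⁻¹ (n - ℓ))) := by
  have hn0 : (n : ℂ) ≠ 0 := by exact_mod_cast (by omega : n ≠ 0)
  have hα : (alphaQ n ℓ : ℂ) = (ℓ : ℂ) / n - 1 / 2 := by simp [alphaQ]
  set r : ℂ := (alphaQ n ℓ : ℂ) with hr
  have hnτ : 0 < ((n : ℂ) * τ).im := by
    have : ((n : ℂ) * τ).im = n * τ.im := by simp
    rw [this]
    have : (0 : ℝ) < n := by exact_mod_cast hn
    positivity
  have h1 : thetaR (alphaQ n ℓ) ((n : ℂ) * τ) (σ + 1/2) =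
      cexp (π * I * r ^ 2 * (n * τ) + π * I * r) * cexp (2 * π * I * r * σ) *
      jacobiTheta₂ (σ + 1/2 + r * (n * τ)) (n * τ) := by
    rw [thetaR, jacobiTheta₂, ← tsum_mul_left]
    refine tsum_congr fun k => ?_
    rw [jacobiTheta₂_term, ← Complex.exp_add, ← Complex.exp_add]
    congr 1
    ring
  have hQ : cexp (2 * π * I * (n * τ)) = cexp (2 * π * I * τ) ^ n := by
    rw [← Complex.exp_nat_mul]; congr 1; ring
  have hy : cexp (2 * π * I * (σ + 1/2 + r * (n * τ)) + π * I * (n * τ)) =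
      -(cexp (2 * π * I * σ) * cexp (2 * π * I * τ) ^ ℓ) := by
    rw [← Complex.exp_nat_mul, ← Complex.exp_add, ← neg_one_mul, ← Complex.exp_pi_mul_I,
      ← Complex.exp_add]
    congr 1
    rw [hα]
    field_simp
    ring
  rw [h1, jtp _ _ hnτ, hy, hQ]
  have hq0 : cexp (2 * π * I * τ) ≠ 0 := exp_ne_zero _
  have hz0 : cexp (2 * π * I * σ) ≠ 0 := exp_ne_zero _
  generalize cexp (2 * π * I * τ) = q at *
  generalize cexp (2 * π * I * σ) = z at *
  congr 2
  · exact tprod_congr fun i => by rw [← pow_mul]; ring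
  · congr 1
    · exact tprod_congr fun i => by rw [← pow_mul]; ring
    · refine tprod_congr fun i => ?_
      obtain ⟨d, rfl⟩ := Nat.exists_eq_add_of_le hℓ
      rw [show ℓ + d - ℓ = d by omega, ← pow_mul, show (ℓ + d) * (i + 1) = (ℓ + d) * i + d + ℓ by ring,
        pow_add _ _ ℓ]
      field_simp
      ring

open Complex Real in
lemma theta_prod_S {n : ℕ} (hn : 1 ≤ n) (S : Finset ℕ)
    (hS : S ⊆ Finset.Icc 1 n) (hsym : ∀ ℓ ∈ S, ℓ ≠ n → n - ℓ ∈ S) (τ σ : ℂ) (hτ : 0 < τ.im) :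
    ∏ ℓ ∈ S.erase n, thetaR (alphaQ n ℓ) ((n : ℂ) * τ) (σ + 1/2) =
      (∏ ℓ ∈ S.erase n, (cexp (π * I * (alphaQ n ℓ : ℂ) ^ 2 * (n * τ) + π * I * (alphaQ n ℓ : ℂ)) *
        PP (cexp (2 * π * I * τ)) n 1 n)) *
      ∏ ℓ ∈ S.erase n, (PP (cexp (2 * π * I * τ)) n (cexp (2 * π * I * σ)) ℓ *
        PP (cexp (2 * π * I * τ)) n (cexp (2 * π * I * σ))⁻¹ ℓ) := by
  have hS' : ∀ ℓ ∈ S.erase n, ℓ ∈ S ∧ 1 ≤ ℓ ∧ ℓ < n := fun ℓ h => by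
    have h1 := Finset.mem_erase.mp h
    have h2 := Finset.mem_Icc.mp (hS h1.2)
    exact ⟨h1.2, h2.1, by omega⟩
  have hmem : ∀ ℓ ∈ S.erase n, n - ℓ ∈ S.erase n := fun ℓ h => by
    have := hS' ℓ h
    exact Finset.mem_erase.mpr ⟨by omega, hsym ℓ this.1 (by omega)⟩
  have hinv : ∀ ℓ ∈ S.erase n, n - (n - ℓ) = ℓ := fun ℓ h => by
    have := hS' ℓ h
    omega
  have hn0 : (n : ℂ) ≠ 0 := by exact_mod_cast (by omega : n ≠ 0)
  have hα : ∀ ℓ, (alphaQ n ℓ : ℂ) = (ℓ : ℂ) / n - 1 / 2 := fun ℓ => by simp [alphaQ]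
  have hsum : ∑ ℓ ∈ S.erase n, (alphaQ n ℓ : ℂ) = 0 := by
    have h1 : ∑ ℓ ∈ S.erase n, (alphaQ n ℓ : ℂ) = ∑ ℓ ∈ S.erase n, -(alphaQ n ℓ : ℂ) := by
      refine Finset.sum_nbij' (fun ℓ => n - ℓ) (fun ℓ => n - ℓ) hmem hmem hinv hinv fun ℓ h => ?_
      rw [hα, hα, Nat.cast_sub (hS' ℓ h).2.2.le]
      field_simp
      ring
    rw [Finset.sum_neg_distrib] at h1
    exact self_eq_neg.mp h1
  have hexp : ∏ ℓ ∈ S.erase n, cexp (2 * π * I * (alphaQ n ℓ : ℂ) * σ) = 1 := by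
    rw [← Complex.exp_sum, ← Finset.sum_mul, ← Finset.mul_sum, hsum]
    simp
  have hrefl : ∏ ℓ ∈ S.erase n, PP (cexp (2 * π * I * τ)) n (cexp (2 * π * I * σ))⁻¹ (n - ℓ) =
      ∏ ℓ ∈ S.erase n, PP (cexp (2 * π * I * τ)) n (cexp (2 * π * I * σ))⁻¹ ℓ :=
    Finset.prod_nbij' (fun ℓ => n - ℓ) (fun ℓ => n - ℓ) hmem hmem hinv hinv fun ℓ h => rfl
  rw [Finset.prod_congr rfl fun ℓ h => theta_prod hn ℓ (hS' ℓ h).2.2.le τ σ hτ]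
  simp only [Finset.prod_mul_distrib]
  rw [hexp, hrefl]
  ring

/-- for `n ≥ 1` and a symmetric `S = {n, ℓ₁, …, ℓ_s} ⊆ {1,…,n}` with `n ∈ S`,
with `x = z^{1/2} - z^{-1/2}`, `z = e^{2πiσ}`, `q = e^{2πiτ}`:
`∑_{k≥0} (-1)^k A_{S,n,k}(q) x^{2k+1}
  = -i ϑ_{1/2}(qⁿ,-z) ∏ⱼ ϑ_{α(n,ℓⱼ)}(qⁿ,-z) / (η(qⁿ)³ ∏ⱼ ϑ_{α(n,ℓⱼ)}(qⁿ,-1))`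
(here `-z = e^{2πi(σ+1/2)}`, `-1 = e^{2πi·(1/2)}`, and the `ℓⱼ` run over `S.erase n`). -/
theorem macmahonA_theta_product_nmem (n : ℕ) (hn : 1 ≤ n) (S : Finset ℕ)
    (hS : S ⊆ Finset.Icc 1 n) (hnS : n ∈ S) (hsym : ∀ ℓ ∈ S, ℓ ≠ n → n - ℓ ∈ S)
    (τ σ : ℂ) (hτ : 0 < τ.im) :
    (∑' k : ℕ, (-1 : ℂ) ^ k *
        ASnk S n k (Complex.exp (2 * (Real.pi : ℂ) * Complex.I * τ)) *
        (Complex.exp ((Real.pi : ℂ) * Complex.I * σ) -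
          Complex.exp (-((Real.pi : ℂ) * Complex.I * σ))) ^ (2 * k + 1)) =
      -Complex.I * (thetaR (1/2) ((n : ℂ) * τ) (σ + 1/2) *
          ∏ ℓ ∈ S.erase n, thetaR (alphaQ n ℓ) ((n : ℂ) * τ) (σ + 1/2)) /
        (etaQ ((n : ℂ) * τ) ^ 3 *
          ∏ ℓ ∈ S.erase n, thetaR (alphaQ n ℓ) ((n : ℂ) * τ) (1/2)) := by
  have hq := norm_q_lt hτ
  have hn0 : (n : ℂ) ≠ 0 := by exact_mod_cast (by omega : n ≠ 0)
  have hθn := theta_prod hn n le_rfl τ σ hτ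
  have hαn : alphaQ n n = 1 / 2 := by
    have : (n : ℚ) ≠ 0 := by exact_mod_cast (by omega : n ≠ 0)
    rw [alphaQ, div_self this]; norm_num
  rw [hαn] at hθn
  have hθσ := theta_prod_S hn S hS hsym τ σ hτ
  have hθ0 := theta_prod_S hn S hS hsym τ 0 hτ
  rw [zero_add] at hθ0
  have heta : etaQ ((n : ℂ) * τ) = Complex.exp (2 * (Real.pi : ℂ) * Complex.I * (n * τ) / 24) *
      PP (Complex.exp (2 * (Real.pi : ℂ) * Complex.I * τ)) n 1 n := by
    rw [etaQ, PP]
    congr 1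
    refine tprod_congr fun m => ?_
    rw [one_mul, ← Complex.exp_nat_mul, ← Complex.exp_nat_mul]
    congr 2
    push_cast
    ring
  rw [hθn, hθσ, hθ0, heta]
  rw [Nat.sub_self, PP_zero hq hn]
  have hE0 : ∏ ℓ ∈ S.erase n, (Complex.exp (Real.pi * Complex.I * (alphaQ n ℓ : ℂ) ^ 2 * (n * τ) +
      Real.pi * Complex.I * (alphaQ n ℓ : ℂ)) *
        PP (Complex.exp (2 * Real.pi * Complex.I * τ)) n 1 n) ≠ 0 :=
    Finset.prod_ne_zero_iff.mpr fun ℓ _ => mul_ne_zero (Complex.exp_ne_zero _) (PP_ne hq hn n hn)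
  have hz0 : Complex.exp (2 * Real.pi * Complex.I * σ) ≠ 0 := Complex.exp_ne_zero _
  have hxz : Complex.exp ((Real.pi : ℂ) * Complex.I * σ) -
      Complex.exp (-((Real.pi : ℂ) * Complex.I * σ)) =
      Complex.exp ((Real.pi : ℂ) * Complex.I * σ) *
        (1 - (Complex.exp (2 * Real.pi * Complex.I * σ))⁻¹) := by
    rw [mul_sub, mul_one, ← Complex.exp_neg, ← Complex.exp_add]
    congr 2
    ring
  have hx2 : (Complex.exp ((Real.pi : ℂ) * Complex.I * σ) -
      Complex.exp (-((Real.pi : ℂ) * Complex.I * σ))) ^ 2 =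
      Complex.exp (2 * Real.pi * Complex.I * σ) + (Complex.exp (2 * Real.pi * Complex.I * σ))⁻¹
        - 2 := by
    have h1 : Complex.exp (2 * Real.pi * Complex.I * σ) =
        Complex.exp ((Real.pi : ℂ) * Complex.I * σ) ^ 2 := by
      rw [← Complex.exp_nat_mul]; congr 1; push_cast; ring
    rw [h1, Complex.exp_neg]
    have := Complex.exp_ne_zero ((Real.pi : ℂ) * Complex.I * σ)
    field_simp
    ring
  -- the prefactor
  have hpre : Complex.exp (Real.pi * Complex.I * (((1 / 2 : ℚ) : ℚ) : ℂ) ^ 2 * (n * τ) +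
      Real.pi * Complex.I * (((1 / 2 : ℚ) : ℚ) : ℂ)) *
      Complex.exp (2 * Real.pi * Complex.I * (((1 / 2 : ℚ) : ℚ) : ℂ) * σ) =
      Complex.I * Complex.exp (2 * (Real.pi : ℂ) * Complex.I * (n * τ) / 24) ^ 3 *
        Complex.exp ((Real.pi : ℂ) * Complex.I * σ) := by
    have hI : Complex.I = Complex.exp (Real.pi / 2 * Complex.I) := Complex.exp_pi_div_two_mul_I.symm
    conv_rhs => rw [← Complex.exp_nat_mul]; enter [1, 1]; rw [hI]
    rw [← Complex.exp_add, ← Complex.exp_add, ← Complex.exp_add]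
    congr 1
    push_cast
    ring
  rw [hpre]
  -- the left-hand side
  set q := Complex.exp (2 * (Real.pi : ℂ) * Complex.I * τ) with hqd
  set z := Complex.exp (2 * (Real.pi : ℂ) * Complex.I * σ) with hzd
  set x := Complex.exp ((Real.pi : ℂ) * Complex.I * σ) -
      Complex.exp (-((Real.pi : ℂ) * Complex.I * σ)) with hxd
  have hL : (∑' k : ℕ, (-1 : ℂ) ^ k * ASnk S n k q * x ^ (2 * k + 1)) =
      x * ∏ ℓ ∈ S, ∏' i : ℕ, (1 + (-x ^ 2) * (q ^ (n * i + ℓ) / (1 - q ^ (n * i + ℓ)) ^ 2)) := by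
    rw [← prod_split S n hn hS (fun j => (-x ^ 2) * (q ^ j / (1 - q ^ j) ^ 2)) (summ_w hq _),
      ← lhs_prod S n _ (summ_w hq _), ← tsum_mul_left]
    refine tsum_congr fun k => ?_
    simp only [Finset.prod_mul_distrib, Finset.prod_const, Finset.card_univ, Fintype.card_fin]
    rw [tsum_mul_left, neg_pow (x ^ 2), ← pow_mul, pow_succ]
    simp only [ASnk]
    ring
  have hc : -x ^ 2 = -(z + z⁻¹ - 2) := by rw [hx2]
  have hP : ∀ ℓ ∈ S, ∏' i : ℕ, (1 + (-x ^ 2) * (q ^ (n * i + ℓ) / (1 - q ^ (n * i + ℓ)) ^ 2)) =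
      PP q n z ℓ * PP q n z⁻¹ ℓ / (PP q n 1 ℓ * PP q n 1 ℓ) := by
    intro ℓ hℓ
    have h1 := (Finset.mem_Icc.mp (hS hℓ)).1
    have h2 := PP_ne hq hn ℓ h1
    rw [eq_div_iff (mul_ne_zero h2 h2)]
    exact W_eq hq hn z hz0 ℓ h1 _ hc
  rw [hL, Finset.prod_congr rfl hP, ← Finset.mul_prod_erase S _ hnS, Finset.prod_div_distrib]
  have hone : Complex.exp (2 * (Real.pi : ℂ) * Complex.I * 0) = 1 := by simp
  rw [hone, inv_one]
  have hD : ∏ ℓ ∈ S.erase n, (PP q n 1 ℓ * PP q n 1 ℓ) ≠ 0 :=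
    Finset.prod_ne_zero_iff.mpr fun ℓ h => by
      have h2 := PP_ne hq hn ℓ (Finset.mem_Icc.mp (hS (Finset.mem_of_mem_erase h))).1
      exact mul_ne_zero h2 h2
  have hPn := PP_ne hq hn n hn
  have hexp0 := Complex.exp_ne_zero (2 * (Real.pi : ℂ) * Complex.I * (n * τ) / 24)
  rw [hxz]
  clear hθn hθσ hθ0 heta hP hL
  generalize Complex.exp ((Real.pi : ℂ) * Complex.I * σ) = s at *
  generalize Complex.exp (2 * (Real.pi : ℂ) * Complex.I * (n * τ) / 24) = e24 at *
  generalize PP q n 1 n = p1 at *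
  generalize PP q n z n = p2 at *
  generalize PP q n z⁻¹ n = p3 at *
  generalize ∏ ℓ ∈ S.erase n, (PP q n 1 ℓ * PP q n 1 ℓ) = D at *
  generalize ∏ ℓ ∈ S.erase n, (PP q n z ℓ * PP q n z⁻¹ ℓ) = F at *
  generalize z⁻¹ = zi at *
  generalize (∏ ℓ ∈ S.erase n, (_ : ℂ)) = E at *
  have hI2 : -Complex.I * Complex.I = 1 := by simp
  field_simp
  rw [Complex.I_sq]
  ring
end

section
/- Fix n ≥ 1 and symmetric S ⊆ {1,…,n} with n ∉ S. Then with x = z^{1/2} − z^{-1/2}: ∑_{k≥0} B_{S,n,k}(q) x^{2k} = ∏_{j=1}^s ϑ_{α(n,ℓ_j)}(q^n, z) / ϑ_{α(n,ℓ_j)}(q^n, 1). -/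
/-- `B_{S,n,k}(q) = ∑_{0<m₁<⋯<m_k, mᵢ mod n ∈ S} q^{m₁+⋯+m_k}/∏(1+q^{mᵢ})²`,
with `B_{S,n,0} = 1`. -/
noncomputable def BSnk (S : Finset ℕ) (n k : ℕ) (q : ℂ) : ℂ :=
  ∑' f : {f : Fin k → ℕ //
      StrictMono f ∧ (∀ i, 0 < f i) ∧ ∀ i, ∃ ℓ ∈ S, f i % n = ℓ % n},
    ∏ i, q ^ (f.1 i) / (1 + q ^ (f.1 i)) ^ 2

open Filter Topology

noncomputable def jP (Q : ℂ) (m : ℕ) : ℂ := ∏ i ∈ Finset.range m, (1 - Q ^ (i + 1))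

noncomputable def jI (Q : ℂ) (m : ℤ) : ℂ := if 0 ≤ m then (jP Q m.toNat)⁻¹ else 0

lemma jone_sub_ne {Q : ℂ} (hQ : ‖Q‖ < 1) (i : ℕ) : 1 - Q ^ (i + 1) ≠ 0 := by
  intro h
  have h1 : Q ^ (i + 1) = 1 := by linear_combination -h
  have h2 : ‖Q‖ ^ (i + 1) = 1 := by rw [← norm_pow, h1, norm_one]
  have h3 := pow_lt_one₀ (norm_nonneg Q) hQ (Nat.succ_ne_zero i)
  simp only [Nat.succ_eq_add_one] at h3
  linarith

lemma jI_pred {Q : ℂ} (hQ : ‖Q‖ < 1) (m : ℤ) : jI Q (m - 1) = (1 - Q ^ m) * jI Q m := by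
  rcases lt_trichotomy m 0 with h | h | h
  · unfold jI
    rw [if_neg (by omega), if_neg (by omega), mul_zero]
  · subst h; simp [jI]
  · obtain ⟨k, rfl⟩ : ∃ k : ℕ, m = (k : ℤ) + 1 := ⟨(m - 1).toNat, by omega⟩
    have h1 : ((k : ℤ) + 1).toNat = k + 1 := by omega
    have h2 : (Q : ℂ) ^ ((k : ℤ) + 1) = Q ^ (k + 1) := by exact_mod_cast zpow_natCast Q (k + 1)
    have h3 := jone_sub_ne hQ k
    have h4 : (0 : ℤ) ≤ (k : ℤ) + 1 := by omega
    simp only [jI, h4, if_true, h1, h2, add_sub_cancel_right, Int.toNat_natCast]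
    simp only [jP, Finset.prod_range_succ, mul_inv]
    rw [if_pos (by omega)]
    field_simp

noncomputable def jC (Q : ℂ) (N : ℕ) (k : ℤ) : ℂ := jP Q (2 * N) * jI Q (N + k) * jI Q (N - k)

lemma jfinite {Q : ℂ} (hQ : ‖Q‖ < 1) (hQ0 : Q ≠ 0) {u : ℂ} (hu : u ≠ 0) (g : ℤ → ℂ) (g0 : g 0 = 1)
    (hg : ∀ k, g (k + 1) = g k * Q ^ k * u) (N : ℕ) :
    HasSum (fun k => jC Q N k * g k)
      (∏ j ∈ Finset.range N, ((1 + u * Q ^ j) * (1 + u⁻¹ * Q ^ (j + 1)))) := by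
  induction N with
  | zero =>
    have := hasSum_single (f := fun k : ℤ => jC Q 0 k * g k) 0 (by
      intro k hk
      rcases lt_or_gt_of_ne hk with h | h
      · simp [jC, jI, not_le.mpr h]
      · simp [jC, jI, not_le.mpr h])
    simpa [jC, jI, jP, g0] using this
  | succ N ih =>
    rw [Finset.prod_range_succ]
    have e1 := ((Equiv.subRight (1 : ℤ)).hasSum_iff).mpr ih
    have e2 := ((Equiv.addRight (1 : ℤ)).hasSum_iff).mpr ih
    have := ((ih.mul_left (1 + Q ^ (2 * N + 1))).add (e1.mul_left (u * Q ^ N))).add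
      (e2.mul_left (u⁻¹ * Q ^ (N + 1)))
    convert this using 1
    · rfl
    · funext k
      simp only [Function.comp, Equiv.subRight_apply, Equiv.coe_addRight]
      have hg1 : g k * Q = g (k - 1) * Q ^ k * u := by
        have := hg (k - 1)
        rw [sub_add_cancel, zpow_sub_one₀ hQ0] at this
        rw [this]; field_simp
      rw [hg k]
      have hC1 : jC Q (N + 1) k = jP Q (2 * N) * (1 - Q ^ (2 * N + 1)) * (1 - Q ^ (2 * N + 2)) *
          jI Q (N + 1 + k) * jI Q (N + 1 - k) := by
        simp only [jC]
        rw [show 2 * (N + 1) = 2 * N + 1 + 1 by ring]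
        simp only [jP, Finset.prod_range_succ]
        push_cast; ring
      have i1 := jI_pred hQ (N + 1 + k)
      have i2 := jI_pred hQ (N + 1 - k)
      have i3 := jI_pred hQ (N + k)
      have i4 := jI_pred hQ (N - k)
      rw [show (N : ℤ) + 1 + k - 1 = N + k by ring] at i1
      rw [show (N : ℤ) + 1 - k - 1 = N - k by ring] at i2
      have z1 : Q ^ ((N : ℤ) + k) = Q ^ N * Q ^ k := by rw [zpow_add₀ hQ0, zpow_natCast]
      have z2 : Q ^ ((N : ℤ) - k) = Q ^ N / Q ^ k := by rw [zpow_sub₀ hQ0, zpow_natCast]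
      have z3 : Q ^ ((N : ℤ) + 1 + k) = Q ^ N * Q * Q ^ k := by
        rw [zpow_add₀ hQ0, zpow_add_one₀ hQ0, zpow_natCast]
      have z4 : Q ^ ((N : ℤ) + 1 - k) = Q ^ N * Q / Q ^ k := by
        rw [zpow_sub₀ hQ0, zpow_add_one₀ hQ0, zpow_natCast]
      rw [z3] at i1; rw [z4] at i2; rw [z1] at i3; rw [z2] at i4
      rw [hC1]
      simp only [jC]
      rw [show (N : ℤ) + (k - 1) = N + k - 1 by ring, show (N : ℤ) - (k - 1) = N + 1 - k by ring,
        show (N : ℤ) + (k + 1) = N + 1 + k by ring, show (N : ℤ) - (k + 1) = N - k - 1 by ring]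
      rw [i3, i4, i1, i2]
      have hk : Q ^ k ≠ 0 := zpow_ne_zero _ hQ0
      have hgk : g (k - 1) = g k * Q / (Q ^ k * u) := by
        rw [hg1]; field_simp
      rw [hgk]
      generalize jI Q (N + 1 + k) = a
      generalize jI Q (N + 1 - k) = b
      generalize g k = gk
      generalize jP Q (2 * N) = p
      have p1 : Q ^ (2 * N + 1) = (Q ^ N) ^ 2 * Q := by ring
      have p2 : Q ^ (2 * N + 2) = (Q ^ N) ^ 2 * Q ^ 2 := by ring
      rw [p1, p2, pow_succ Q N]
      generalize Q ^ k = y at *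
      generalize Q ^ N = w at *
      field_simp
      ring
    · generalize (∏ j ∈ Finset.range N, (1 + u * Q ^ j) * (1 + u⁻¹ * Q ^ (j + 1))) = p
      field_simp
      ring

lemma jP_tendsto {Q : ℂ} (hQ : ‖Q‖ < 1) :
    ∃ L : ℂ, L ≠ 0 ∧ Tendsto (jP Q) atTop (𝓝 L) := by
  have hs : Summable (fun i : ℕ => ‖-Q ^ (i + 1)‖) := by
    simp only [norm_neg, norm_pow]
    exact (summable_nat_add_iff 1).mpr (summable_geometric_of_lt_one (norm_nonneg _) hQ)
  refine ⟨∏' i : ℕ, (1 + -Q ^ (i + 1)), ?_, ?_⟩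
  · apply tprod_one_add_ne_zero_of_summable _ hs
    intro i
    rw [← sub_eq_add_neg]; exact jone_sub_ne hQ i
  · have := (multipliable_one_add_of_summable hs).tendsto_prod_tprod_nat
    simp only [← sub_eq_add_neg] at this ⊢
    exact this

lemma jtriple {Q : ℂ} (hQ : ‖Q‖ < 1) (hQ0 : Q ≠ 0) :
    ∃ A : ℂ, A ≠ 0 ∧ ∀ (u : ℂ) (_ : u ≠ 0) (g : ℤ → ℂ) (_ : g 0 = 1)
    (_ : ∀ k, g (k + 1) = g k * Q ^ k * u) (_ : Summable (fun k => ‖g k‖)),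
    ∑' k, g k = A * ((∏' j : ℕ, (1 + u * Q ^ j)) * ∏' j : ℕ, (1 + u⁻¹ * Q ^ (j + 1))) := by
  obtain ⟨L, hL, hT⟩ := jP_tendsto hQ
  refine ⟨L, hL, fun u hu g g0 hg hs => ?_⟩
  have hTi : Tendsto (fun m => (jP Q m)⁻¹) atTop (𝓝 L⁻¹) := hT.inv₀ hL
  obtain ⟨M1, hM1⟩ := (Metric.isBounded_range_of_tendsto _ hT).exists_norm_le
  obtain ⟨M2, hM2⟩ := (Metric.isBounded_range_of_tendsto _ hTi).exists_norm_le
  have hM1' : ∀ m, ‖jP Q m‖ ≤ M1 := fun m => hM1 _ ⟨m, rfl⟩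
  have hM2p : 0 ≤ M2 := (norm_nonneg _).trans (hM2 _ ⟨0, rfl⟩)
  have hM1p : 0 ≤ M1 := (norm_nonneg _).trans (hM1' 0)
  have hM2' : ∀ m, ‖jI Q m‖ ≤ M2 := by
    intro m
    unfold jI
    split_ifs
    · exact hM2 _ ⟨_, rfl⟩
    · simpa using hM2p
  have hTI : Tendsto (jI Q) atTop (𝓝 L⁻¹) := by
    have h1 : Tendsto (fun m : ℤ => (jP Q m.toNat)⁻¹) atTop (𝓝 L⁻¹) := by
      apply hTi.comp
      exact tendsto_atTop.mpr fun b => by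
        filter_upwards [eventually_ge_atTop (b : ℤ)] with a ha
        omega
    apply h1.congr'
    filter_upwards [eventually_ge_atTop (0 : ℤ)] with a ha
    simp [jI, ha]
  have hCT : ∀ k, Tendsto (fun N => jC Q N k * g k) atTop (𝓝 (L * L⁻¹ * L⁻¹ * g k)) := by
    intro k
    apply Tendsto.mul_const
    unfold jC
    apply Tendsto.mul
    · apply Tendsto.mul
      · apply hT.comp
        exact tendsto_atTop.mpr fun b => by
          filter_upwards [eventually_ge_atTop b] with a ha
          omega
      · apply hTI.comp
        exact tendsto_atTop_add_const_right _ _ tendsto_natCast_atTop_atTop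
    · apply hTI.comp
      exact tendsto_atTop_add_const_right _ (-k) tendsto_natCast_atTop_atTop
  have h1 := tendsto_tsum_of_dominated_convergence (𝓕 := atTop)
    (f := fun N k => jC Q N k * g k) (bound := fun k => M1 * M2 * M2 * ‖g k‖)
    (hs.mul_left _) hCT (Eventually.of_forall fun N k => by
      rw [norm_mul]
      apply mul_le_mul_of_nonneg_right _ (norm_nonneg _)
      unfold jC
      rw [norm_mul, norm_mul]
      gcongr
      · exact hM1' _
      · exact hM2' _
      · exact hM2' _)
  have hsm : ∀ v : ℂ, Summable (fun j : ℕ => ‖v * Q ^ j‖) := fun v => by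
    simp only [norm_mul, norm_pow]
    exact (summable_geometric_of_lt_one (norm_nonneg _) hQ).mul_left _
  have hsm2 : ∀ v : ℂ, Summable (fun j : ℕ => ‖v * Q ^ (j + 1)‖) := fun v =>
    (summable_nat_add_iff 1).mpr (hsm v)
  have h2 := ((multipliable_one_add_of_summable (hsm u)).tendsto_prod_tprod_nat).mul
    ((multipliable_one_add_of_summable (hsm2 u⁻¹)).tendsto_prod_tprod_nat)
  simp only [(jfinite hQ hQ0 hu g g0 hg _).tsum_eq, Finset.prod_mul_distrib] at h1
  have h3 := tendsto_nhds_unique h2 h1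
  rw [h3, tsum_mul_left]
  field_simp

noncomputable def jF (n : ℕ) (q : ℂ) (a : ℕ) (z : ℂ) : ℂ := ∏' j : ℕ, (1 + z * q ^ (n * j + a))

lemma theta_prod_s16 (n ℓ : ℕ) (h1 : 1 ≤ ℓ) (h2 : ℓ < n) (τ : ℂ) (hτ : 0 < τ.im) :
    ∃ B : ℂ, B ≠ 0 ∧ ∀ σ : ℂ, thetaR (alphaQ n ℓ) ((n : ℂ) * τ) σ =
      B * Complex.exp (2 * (Real.pi : ℂ) * Complex.I * (alphaQ n ℓ : ℚ) * σ) *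
        (jF n (Complex.exp (2 * (Real.pi : ℂ) * Complex.I * τ)) ℓ
            (Complex.exp (2 * (Real.pi : ℂ) * Complex.I * σ)) *
          jF n (Complex.exp (2 * (Real.pi : ℂ) * Complex.I * τ)) (n - ℓ)
            (Complex.exp (2 * (Real.pi : ℂ) * Complex.I * σ))⁻¹) := by
  have hn : (n : ℂ) ≠ 0 := by exact_mod_cast (by omega : n ≠ 0)
  have hnr : (0 : ℝ) < n := by exact_mod_cast (by omega : 0 < n)
  have him : 0 < ((n : ℂ) * τ).im := by simp; positivity
  set q := Complex.exp (2 * (Real.pi : ℂ) * Complex.I * τ) with hq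
  have hq0 : q ≠ 0 := Complex.exp_ne_zero _
  have hq1 : ‖q‖ < 1 := by
    rw [hq, Complex.norm_exp, Real.exp_lt_one_iff]
    simp
    positivity
  have hQ : ‖q ^ n‖ < 1 := by
    rw [norm_pow]; exact pow_lt_one₀ (norm_nonneg _) hq1 (by omega)
  obtain ⟨A, hA, hJ⟩ := jtriple hQ (pow_ne_zero n hq0)
  refine ⟨Complex.exp ((Real.pi : ℂ) * Complex.I * (alphaQ n ℓ : ℚ) ^ 2 * (n * τ)) * A,
    mul_ne_zero (Complex.exp_ne_zero _) hA, fun σ => ?_⟩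
  set z := Complex.exp (2 * (Real.pi : ℂ) * Complex.I * σ) with hz
  have hz0 : z ≠ 0 := Complex.exp_ne_zero _
  have hr : ((alphaQ n ℓ : ℚ) : ℂ) = (ℓ : ℂ) / n - 1 / 2 := by
    unfold alphaQ; push_cast; ring
  have key := hJ (q ^ ℓ * z) (mul_ne_zero (pow_ne_zero _ hq0) hz0)
    (fun k : ℤ => Complex.exp ((Real.pi : ℂ) * Complex.I * (n * τ) * ((k : ℂ) ^ 2 - k) +
      2 * (Real.pi : ℂ) * Complex.I * k * (ℓ * τ + σ))) (by simp) (by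
      intro k
      rw [hq, hz, ← Complex.exp_nat_mul, ← Complex.exp_nat_mul, ← Complex.exp_int_mul,
        ← Complex.exp_add, ← Complex.exp_add, ← Complex.exp_add]
      congr 1
      push_cast
      ring) (by
      have := ((summable_jacobiTheta₂_term_iff (ℓ * τ + σ - n * τ / 2) (n * τ)).mpr him).norm
      refine this.congr fun k => ?_
      unfold jacobiTheta₂_term
      congr 2
      ring)
  have e1 : (∏' j : ℕ, (1 + q ^ ℓ * z * (q ^ n) ^ j)) = jF n q ℓ z := by
    unfold jF
    refine tprod_congr fun j => ?_
    ring
  have e2 : (∏' j : ℕ, (1 + (q ^ ℓ * z)⁻¹ * (q ^ n) ^ (j + 1))) = jF n q (n - ℓ) z⁻¹ := by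
    unfold jF
    refine tprod_congr fun j => ?_
    have : (q ^ n) ^ (j + 1) = q ^ (n * j + (n - ℓ)) * q ^ ℓ := by
      rw [← pow_add, ← pow_mul]
      congr 1
      have : n - ℓ + ℓ = n := by omega
      rw [add_assoc, this]; ring
    rw [this]
    field_simp
  rw [e1, e2] at key
  have e3 : thetaR (alphaQ n ℓ) ((n : ℂ) * τ) σ =
      Complex.exp ((Real.pi : ℂ) * Complex.I * (alphaQ n ℓ : ℚ) ^ 2 * (n * τ)) *
      Complex.exp (2 * (Real.pi : ℂ) * Complex.I * (alphaQ n ℓ : ℚ) * σ) *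
      ∑' k : ℤ, Complex.exp ((Real.pi : ℂ) * Complex.I * (n * τ) * ((k : ℂ) ^ 2 - k) +
      2 * (Real.pi : ℂ) * Complex.I * k * (ℓ * τ + σ)) := by
    unfold thetaR
    rw [← tsum_mul_left]
    refine tsum_congr fun k => ?_
    rw [← Complex.exp_add, ← Complex.exp_add, hr]
    congr 1
    field_simp
    ring
  rw [e3, key]
  ring

abbrev jIdx (S : Finset ℕ) (n : ℕ) : Type := {m : ℕ // 0 < m ∧ ∃ ℓ ∈ S, m % n = ℓ % n}

abbrev jSeq (S : Finset ℕ) (n k : ℕ) : Type := {f : Fin k → ℕ //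
      StrictMono f ∧ (∀ i, 0 < f i) ∧ ∀ i, ∃ ℓ ∈ S, f i % n = ℓ % n}

def jEmb (S : Finset ℕ) (n k : ℕ) (f : jSeq S n k) : Fin k ↪ jIdx S n :=
  ⟨fun i => ⟨f.1 i, f.2.2.1 i, f.2.2.2 i⟩, fun i j h => f.2.1.injective (Subtype.ext_iff.mp h)⟩

def jMap (S : Finset ℕ) (n : ℕ) (p : Σ k, jSeq S n k) : Finset (jIdx S n) :=
  Finset.univ.map (jEmb S n p.1 p.2)

lemma jMap_bij (S : Finset ℕ) (n : ℕ) : Function.Bijective (jMap S n) := by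
  constructor
  · rintro ⟨k, f⟩ ⟨k', f'⟩ h
    have hk : k = k' := by
      have := congrArg Finset.card h
      simpa [jMap] using this
    subst hk
    congr 1
    apply Subtype.ext
    apply (StrictMono.range_inj f.2.1 f'.2.1).mp
    ext m
    have h' : ∀ a : jIdx S n, a ∈ jMap S n ⟨k, f⟩ ↔ a ∈ jMap S n ⟨k, f'⟩ := fun a => by rw [h]
    simp only [jMap, Finset.mem_map, Finset.mem_univ, true_and, jEmb,
      Function.Embedding.coeFn_mk] at h'
    constructor
    · rintro ⟨i, rfl⟩
      obtain ⟨j, hj⟩ := (h' ⟨f.1 i, f.2.2.1 i, f.2.2.2 i⟩).mp ⟨i, rfl⟩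
      exact ⟨j, Subtype.ext_iff.mp hj⟩
    · rintro ⟨i, rfl⟩
      obtain ⟨j, hj⟩ := (h' ⟨f'.1 i, f'.2.2.1 i, f'.2.2.2 i⟩).mpr ⟨i, rfl⟩
      exact ⟨j, Subtype.ext_iff.mp hj⟩
  · intro s
    refine ⟨⟨s.card, fun i => (s.orderEmbOfFin rfl i).1, ?_, ?_, ?_⟩, ?_⟩
    · intro i j hij
      exact (s.orderEmbOfFin rfl).strictMono hij
    · intro i; exact (s.orderEmbOfFin rfl i).2.1
    · intro i; exact (s.orderEmbOfFin rfl i).2.2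
    · ext a
      simp only [jMap, Finset.mem_map, Finset.mem_univ, true_and, jEmb,
        Function.Embedding.coeFn_mk]
      rw [← Finset.mem_coe, ← Finset.range_orderEmbOfFin s rfl]
      rfl

lemma jgen (S : Finset ℕ) (n : ℕ) (q y : ℂ)
    (hs : Summable (fun m : jIdx S n => ‖y * (q ^ m.1 / (1 + q ^ m.1) ^ 2)‖)) :
    ∑' k : ℕ, BSnk S n k q * y ^ k =
      ∏' m : jIdx S n, (1 + y * (q ^ m.1 / (1 + q ^ m.1) ^ 2)) := by
  have hF := summable_finsetProd_of_summable_norm hs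
  rw [tprod_one_add hF]
  let e := Equiv.ofBijective _ (jMap_bij S n)
  have h2 := e.summable_iff.mpr hF
  simp only [Function.comp_def] at h2
  rw [← e.tsum_eq, Summable.tsum_sigma h2]
  refine tsum_congr fun k => ?_
  unfold BSnk
  rw [← tsum_mul_right]
  refine tsum_congr fun f => ?_
  have h3 : ∏ i ∈ e ⟨k, f⟩, y * (q ^ i.1 / (1 + q ^ i.1) ^ 2) =
      ∏ i : Fin k, y * (q ^ f.1 i / (1 + q ^ f.1 i) ^ 2) :=
    Finset.prod_map Finset.univ (jEmb S n k f)
      (fun i : jIdx S n => y * (q ^ i.1 / (1 + q ^ i.1) ^ 2))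
  rw [h3, Finset.prod_mul_distrib, Finset.prod_const, Finset.card_univ, Fintype.card_fin, mul_comm]

lemma jidx_bij (n : ℕ) (S : Finset ℕ) (hS : ∀ ℓ ∈ S, 1 ≤ ℓ ∧ ℓ < n) :
    Function.Bijective (fun p : S × ℕ => (⟨n * p.2 + p.1.1, by
      have := hS _ p.1.2
      omega, p.1.1, p.1.2, by simp⟩ : jIdx S n)) := by
  constructor
  · rintro ⟨⟨a, ha⟩, j⟩ ⟨⟨b, hb⟩, k⟩ h
    have h := Subtype.ext_iff.mp h
    simp only at h
    have h1 := hS _ ha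
    have h2 := hS _ hb
    have h3 : a = b := by
      have := congrArg (· % n) h
      simpa [Nat.mod_eq_of_lt h1.2, Nat.mod_eq_of_lt h2.2] using this
    subst h3
    have h4 : n * j = n * k := by omega
    have h5 := Nat.eq_of_mul_eq_mul_left (by omega) h4
    subst h5; rfl
  · rintro ⟨m, hm, ℓ, hℓ, h⟩
    refine ⟨⟨⟨ℓ, hℓ⟩, m / n⟩, Subtype.ext ?_⟩
    rw [Nat.mod_eq_of_lt (hS _ hℓ).2] at h
    simp only [← h]
    exact Nat.div_add_mod m n

lemma jF_mult (n a : ℕ) (hn : 1 ≤ n) (q z : ℂ) (hq : ‖q‖ < 1) :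
    Summable (fun j : ℕ => ‖z * q ^ (n * j + a)‖) := by
  have hQ : ‖q‖ ^ n < 1 := pow_lt_one₀ (norm_nonneg _) hq (by omega)
  refine ((summable_geometric_of_lt_one (by positivity) hQ).mul_left (‖z‖ * ‖q‖ ^ a)).congr
    fun j => ?_
  rw [norm_mul, norm_pow, pow_add, pow_mul]; ring

lemma one_add_pow_ne {q : ℂ} (hq : ‖q‖ < 1) {m : ℕ} (hm : 0 < m) : 1 + q ^ m ≠ 0 := by
  intro h
  have h1 : q ^ m = -1 := by linear_combination h
  have h2 : ‖q‖ ^ m = 1 := by rw [← norm_pow, h1, norm_neg, norm_one]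
  have h3 := pow_lt_one₀ (norm_nonneg q) hq hm.ne'
  linarith

lemma jsummable (S : Finset ℕ) (n : ℕ) (q y : ℂ) (hq : ‖q‖ < 1) :
    Summable (fun m : jIdx S n => ‖y * (q ^ m.1 / (1 + q ^ m.1) ^ 2)‖) := by
  have h0 : Summable (fun m : ℕ => ‖y‖ * (‖q‖ ^ m / (1 - ‖q‖) ^ 2)) :=
    ((summable_geometric_of_lt_one (norm_nonneg _) hq).div_const _).mul_left _
  refine Summable.of_nonneg_of_le (fun _ => norm_nonneg _) (fun m => ?_)
    (h0.comp_injective (Subtype.val_injective (p := fun m : ℕ => 0 < m ∧ ∃ ℓ ∈ S, m % n = ℓ % n)))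
  simp only [Function.comp]
  rw [norm_mul, norm_div, norm_pow, norm_pow]
  have h1 : 0 < 1 - ‖q‖ := by linarith
  have h2 : 1 - ‖q‖ ≤ ‖1 + q ^ m.1‖ := by
    have h3 : ‖q‖ ^ m.1 ≤ ‖q‖ := pow_le_of_le_one (norm_nonneg _) hq.le m.2.1.ne'
    have h4 := norm_sub_norm_le (1 : ℂ) (-q ^ m.1)
    rw [sub_neg_eq_add, norm_neg, norm_one, norm_pow] at h4
    linarith
  gcongr

lemma jF_one_ne (n a : ℕ) (hn : 1 ≤ n) (ha : 1 ≤ a) (q : ℂ) (hq : ‖q‖ < 1) : jF n q a 1 ≠ 0 := by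
  unfold jF
  apply tprod_one_add_ne_zero_of_summable _ (jF_mult n a hn q 1 hq)
  intro j
  rw [one_mul]
  exact one_add_pow_ne hq (by omega)

lemma jfactor (n a : ℕ) (hn : 1 ≤ n) (ha : 1 ≤ a) (q : ℂ) (hq : ‖q‖ < 1) (z y : ℂ) (hz : z ≠ 0)
    (hy : y = z + z⁻¹ - 2) :
    ∏' j : ℕ, (1 + y * (q ^ (n * j + a) / (1 + q ^ (n * j + a)) ^ 2)) =
      jF n q a z * jF n q a z⁻¹ / (jF n q a 1 * jF n q a 1) := by
  have hmul : ∀ w : ℂ, Multipliable (fun j : ℕ => 1 + w * q ^ (n * j + a)) := fun w =>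
    multipliable_one_add_of_summable (jF_mult n a hn q w hq)
  have h1 := jF_one_ne n a hn ha q hq
  rw [eq_div_iff (mul_ne_zero h1 h1)]
  have hinv : HasProd (fun j : ℕ => (1 + 1 * q ^ (n * j + a))⁻¹) (jF n q a 1)⁻¹ := by
    exact (hmul 1).hasProd.inv₀ h1
  have H := (((hmul z).hasProd.mul (hmul z⁻¹).hasProd).mul hinv).mul hinv
  have : (fun j : ℕ => (1 + z * q ^ (n * j + a)) * (1 + z⁻¹ * q ^ (n * j + a)) *
      (1 + 1 * q ^ (n * j + a))⁻¹ * (1 + 1 * q ^ (n * j + a))⁻¹) =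
      fun j => (1 + y * (q ^ (n * j + a) / (1 + q ^ (n * j + a)) ^ 2)) := by
    funext j
    have := one_add_pow_ne hq (show 0 < n * j + a by omega)
    rw [hy, one_mul]
    field_simp
    ring
  rw [this] at H
  rw [H.tprod_eq]
  change jF n q a z * jF n q a z⁻¹ * (jF n q a 1)⁻¹ * (jF n q a 1)⁻¹ * _ = _
  generalize jF n q a z⁻¹ = w
  field_simp


/-- for `n ≥ 1` and a symmetric `S ⊆ {1,…,n}` with `n ∉ S`, with
`x = z^{1/2} - z^{-1/2}`, `z = e^{2πiσ}`, `q = e^{2πiτ}`: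
`∑_{k≥0} B_{S,n,k}(q) x^{2k} = ∏_{ℓ∈S} ϑ_{α(n,ℓ)}(qⁿ,z)/ϑ_{α(n,ℓ)}(qⁿ,1)`. -/
theorem macmahonB_theta_product (n : ℕ) (hn : 1 ≤ n) (S : Finset ℕ)
    (hS : S ⊆ Finset.Icc 1 n) (hnS : n ∉ S) (hsym : ∀ ℓ ∈ S, n - ℓ ∈ S)
    (τ σ : ℂ) (hτ : 0 < τ.im) :
    (∑' k : ℕ, BSnk S n k (Complex.exp (2 * (Real.pi : ℂ) * Complex.I * τ)) *
        (Complex.exp ((Real.pi : ℂ) * Complex.I * σ) -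
          Complex.exp (-((Real.pi : ℂ) * Complex.I * σ))) ^ (2 * k)) =
      ∏ ℓ ∈ S, thetaR (alphaQ n ℓ) ((n : ℂ) * τ) σ /
        thetaR (alphaQ n ℓ) ((n : ℂ) * τ) 0 := by
  have hS' : ∀ ℓ ∈ S, 1 ≤ ℓ ∧ ℓ < n := fun ℓ hℓ => by
    have h1 := Finset.mem_Icc.mp (hS hℓ)
    have h2 : ℓ ≠ n := fun h => hnS (h ▸ hℓ)
    omega
  have hq1 : ‖Complex.exp (2 * (Real.pi : ℂ) * Complex.I * τ)‖ < 1 := by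
    rw [Complex.norm_exp, Real.exp_lt_one_iff]
    simp
    positivity
  choose! B hB hth using fun (ℓ : ℕ) (hℓ : ℓ ∈ S) =>
    theta_prod_s16 n ℓ (hS' ℓ hℓ).1 (hS' ℓ hℓ).2 τ hτ
  generalize Complex.exp (2 * (Real.pi : ℂ) * Complex.I * τ) = q at *
  set y := (Complex.exp ((Real.pi : ℂ) * Complex.I * σ) -
          Complex.exp (-((Real.pi : ℂ) * Complex.I * σ))) ^ 2 with hy
  set z := Complex.exp (2 * (Real.pi : ℂ) * Complex.I * σ) with hz
  have hz0 : z ≠ 0 := Complex.exp_ne_zero _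
  have hyz : y = z + z⁻¹ - 2 := by
    have e : z = Complex.exp ((Real.pi : ℂ) * Complex.I * σ) ^ 2 := by
      rw [hz, ← Complex.exp_nat_mul]; congr 1; push_cast; ring
    have := Complex.exp_ne_zero ((Real.pi : ℂ) * Complex.I * σ)
    rw [hy, e, Complex.exp_neg]
    field_simp
    ring
  simp only [pow_mul, ← hy]
  have hsum := jsummable S n q y hq1
  rw [jgen S n q y hsum]
  let e := Equiv.ofBijective _ (jidx_bij n S hS')
  have hm := e.multipliable_iff.mpr (multipliable_one_add_of_summable hsum)
  simp only [Function.comp_def] at hm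
  rw [← e.tprod_eq, Multipliable.tprod_prod' hm, tprod_fintype]
  · have hl : ∀ b : S, ∏' c : ℕ, (1 + y * (q ^ (e (b, c)).1 / (1 + q ^ (e (b, c)).1) ^ 2)) =
        jF n q b z * jF n q b z⁻¹ / (jF n q b 1 * jF n q b 1) := fun b =>
      jfactor n b hn (hS' _ b.2).1 q hq1 z y hz0 hyz
    rw [Finset.prod_congr rfl (fun b _ => hl b)]
    rw [Finset.prod_coe_sort S (fun b => jF n q b z * jF n q b z⁻¹ / (jF n q b 1 * jF n q b 1))]
    have hr : ∀ ℓ ∈ S, thetaR (alphaQ n ℓ) ((n : ℂ) * τ) σ / thetaR (alphaQ n ℓ) ((n : ℂ) * τ) 0 =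
        Complex.exp (2 * (Real.pi : ℂ) * Complex.I * (alphaQ n ℓ : ℚ) * σ) *
          ((jF n q ℓ z * jF n q (n - ℓ) z⁻¹) / (jF n q ℓ 1 * jF n q (n - ℓ) 1)) := by
      intro ℓ hℓ
      have hb := hB ℓ hℓ
      have h1 := jF_one_ne n ℓ hn (hS' ℓ hℓ).1 q hq1
      have h2 := jF_one_ne n (n - ℓ) hn (hS' _ (hsym ℓ hℓ)).1 q hq1
      rw [hth ℓ hℓ σ, hth ℓ hℓ 0, ← hz]
      simp only [mul_zero, Complex.exp_zero, inv_one, mul_one]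
      field_simp
    rw [Finset.prod_congr rfl hr]
    have hinv : ∀ ℓ ∈ S, n - (n - ℓ) = ℓ := fun ℓ hℓ => by
      have := hS' ℓ hℓ
      omega
    have hrefl : ∀ w : ℂ, ∏ ℓ ∈ S, jF n q (n - ℓ) w = ∏ ℓ ∈ S, jF n q ℓ w := fun w =>
      Finset.prod_nbij' (fun ℓ => n - ℓ) (fun ℓ => n - ℓ) hsym hsym hinv hinv (fun _ _ => rfl)
    have hn0 : (n : ℚ) ≠ 0 := by exact_mod_cast (by omega : n ≠ 0)
    have hsr : ∑ ℓ ∈ S, alphaQ n ℓ = 0 := by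
      have h1 : ∑ ℓ ∈ S, alphaQ n (n - ℓ) = ∑ ℓ ∈ S, alphaQ n ℓ :=
        Finset.sum_nbij' (fun ℓ => n - ℓ) (fun ℓ => n - ℓ) hsym hsym hinv hinv (fun _ _ => rfl)
      have h2 : ∑ ℓ ∈ S, alphaQ n (n - ℓ) = ∑ ℓ ∈ S, -alphaQ n ℓ := by
        refine Finset.sum_congr rfl fun ℓ hℓ => ?_
        unfold alphaQ
        rw [Nat.cast_sub (hS' ℓ hℓ).2.le]
        field_simp
        ring
      rw [Finset.sum_neg_distrib] at h2
      linarith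
    have hexp : ∏ ℓ ∈ S, Complex.exp (2 * (Real.pi : ℂ) * Complex.I * (alphaQ n ℓ : ℚ) * σ) = 1 := by
      rw [← Complex.exp_sum, ← Finset.sum_mul, ← Finset.mul_sum, ← Rat.cast_sum, hsr]
      simp
    rw [Finset.prod_mul_distrib, hexp, one_mul]
    simp only [Finset.prod_div_distrib, Finset.prod_mul_distrib, hrefl]
  · intro b
    refine multipliable_one_add_of_summable ?_
    have := (e.summable_iff.mpr hsum).comp_injective (Prod.mk_right_injective b)
    exact this
end
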